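/- arXiv:2204.12455 — 3 statements merged into one kernel-verified Lean document; each statement's English description precedes it below -/
import Mathlib

section
/- Let d ≥ 2 and δ ≥ d be positive integers and L ≥ 1 a real number, and let G be an (L, δ)-almost-biregular bipartite graph such that L·δ ≤ 2^{⌊δ/(d−1)⌋}. Then G has a (4, d)-almost-biregular subgraph. -/
variable {V : Type*}

/-- `G` is a bipartite graph with parts `A` and `B`: the parts are disjoint, cover all
vertices, and every edge goes between `A` and `B`. -/
def BipartiteWith (G : SimpleGraph V) (A B : Set V) : Prop :=
  Disjoint A B ∧ A ∪ B = Set.univ ∧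
    ∀ ⦃u v : V⦄, G.Adj u v → (u ∈ A ∧ v ∈ B) ∨ (u ∈ B ∧ v ∈ A)

/-- `G` contains no complete bipartite subgraph `K_{k,k}`. -/
def KkkFree (G : SimpleGraph V) (k : ℕ) : Prop :=
  ¬ ∃ (S T : Finset V), Disjoint S T ∧ S.card = k ∧ T.card = k ∧
      ∀ u ∈ S, ∀ v ∈ T, G.Adj u v

/-- The number of edges of `G`. -/
noncomputable def edgeCount (G : SimpleGraph V) : ℕ := G.edgeSet.ncard

/-- The degree of `v` in `G`. -/
noncomputable def deg (G : SimpleGraph V) (v : V) : ℕ := (G.neighborSet v).ncard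

/-- The codegree of `u` and `u'` in `G`: the number of their common neighbours. -/
noncomputable def codeg (G : SimpleGraph V) (u u' : V) : ℕ :=
  (G.neighborSet u ∩ G.neighborSet u').ncard

/-- The average degree of `G`, as a real number. -/
noncomputable def avgDeg [Fintype V] (G : SimpleGraph V) : ℝ :=
  2 * (edgeCount G : ℝ) / (Fintype.card V : ℝ)

/-- The number of edges of a subgraph. -/
noncomputable def subEdgeCount {G : SimpleGraph V} (H : G.Subgraph) : ℕ := H.edgeSet.ncard

/-- The degree of a vertex in a subgraph. -/
noncomputable def subDeg {G : SimpleGraph V} (H : G.Subgraph) (v : V) : ℕ :=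
  (H.neighborSet v).ncard

/-- The average degree of a subgraph. -/
noncomputable def subAvgDeg {G : SimpleGraph V} (H : G.Subgraph) : ℝ :=
  2 * (subEdgeCount H : ℝ) / (H.verts.ncard : ℝ)

/-- A subgraph `H` is `K`-almost-regular: its maximum degree is at most `K` times its
minimum degree. -/
def SubAlmostRegular {G : SimpleGraph V} (H : G.Subgraph) (K : ℝ) : Prop :=
  ∀ v ∈ H.verts, ∀ w ∈ H.verts, (subDeg H v : ℝ) ≤ K * (subDeg H w : ℝ)

/-- `G` has a nonempty `k`-regular subgraph. -/
def HasRegularSubgraph (G : SimpleGraph V) (k : ℕ) : Prop :=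
  ∃ H : G.Subgraph, H.verts.Nonempty ∧ ∀ v ∈ H.verts, subDeg H v = k

/-- `G` has a nonempty `K`-almost-regular subgraph with average degree at least `c`. -/
def HasAlmostRegularSubgraph (G : SimpleGraph V) (K : ℝ) (c : ℝ) : Prop :=
  ∃ H : G.Subgraph, H.verts.Nonempty ∧ SubAlmostRegular H K ∧ c ≤ subAvgDeg H

/-- `G` is `(L, d)`-almost-biregular with parts `A` and `B`. -/
def IsAlmostBiregular (G : SimpleGraph V) (A B : Set V) (L : ℝ) (d : ℕ) : Prop :=
  BipartiteWith G A B ∧ A.Nonempty ∧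
    (∀ v ∈ B, deg G v = d) ∧
    (d : ℝ) ≤ (edgeCount G : ℝ) / (A.ncard : ℝ) ∧
    ∀ u ∈ A, (deg G u : ℝ) ≤ L * ((edgeCount G : ℝ) / (A.ncard : ℝ))

/-- A subgraph `H` of `G` is `(L, d)`-almost-biregular with parts `A` and `B`. -/
def SubIsAlmostBiregular {G : SimpleGraph V} (H : G.Subgraph) (A B : Set V)
    (L : ℝ) (d : ℕ) : Prop :=
  Disjoint A B ∧ A ∪ B = H.verts ∧
    (∀ ⦃u v : V⦄, H.Adj u v → (u ∈ A ∧ v ∈ B) ∨ (u ∈ B ∧ v ∈ A)) ∧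
    A.Nonempty ∧
    (∀ v ∈ B, subDeg H v = d) ∧
    (d : ℝ) ≤ (subEdgeCount H : ℝ) / (A.ncard : ℝ) ∧
    ∀ u ∈ A, (subDeg H u : ℝ) ≤ L * ((subEdgeCount H : ℝ) / (A.ncard : ℝ))

lemma exists_subset_card_eq_of_le {α β : Type*} (B : Finset β) (N : β → Finset α) (d : ℕ)
    (hN : ∀ b ∈ B, d ≤ (N b).card) :
    ∃ N' : β → Finset α, ∀ b ∈ B, N' b ⊆ N b ∧ (N' b).card = d := by
  have hsub : ∀ b, ∃ M : Finset α, b ∈ B → M ⊆ N b ∧ M.card = d := by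
    intro b
    by_cases hb : b ∈ B
    · obtain ⟨M, h1, h2⟩ := Finset.exists_subset_card_eq (hN b hb)
      exact ⟨M, fun _ => ⟨h1, h2⟩⟩
    · exact ⟨∅, fun h => absurd h hb⟩
  choose N' hN' using hsub
  exact ⟨N', hN'⟩

lemma card_filter_mem_mono {α β : Type*} [DecidableEq α] {B B' : Finset β}
    {N N' : β → Finset α} (hB : B' ⊆ B) (hN : ∀ b ∈ B', N' b ⊆ N b) (u : α) :
    (B'.filter fun b => u ∈ N' b).card ≤ (B.filter fun b => u ∈ N b).card := by
  refine Finset.card_le_card fun b hb => ?_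
  rw [Finset.mem_filter] at hb ⊢
  exact ⟨hB hb.1, hN b hb.1 hb.2⟩

/-- Hall's theorem applied to the edges: each edge is either discarded, at most `δ - d` times at
each vertex of `B`, or kept, at most `Δ` times at each vertex on the other side. -/
lemma exists_bounded_selection_or_dense_subset {α β : Type*} [DecidableEq α]
    (B : Finset β) (N : β → Finset α) {d δ : ℕ} (Δ : ℕ) (hdδ : d ≤ δ)
    (hN : ∀ b ∈ B, (N b).card = δ) :
    (∃ N' : β → Finset α, (∀ b ∈ B, N' b ⊆ N b ∧ (N' b).card = d) ∧
      ∀ u, (B.filter fun b => u ∈ N' b).card ≤ Δ) ∨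
    ∃ (S : Finset α) (T : Finset β), S.Nonempty ∧ (∀ u ∈ S, ∃ b ∈ B, u ∈ N b) ∧ T ⊆ B ∧
      (∀ b ∈ T, δ - d + 1 ≤ (N b ∩ S).card) ∧ Δ * S.card < d * T.card := by
  classical
  let ι := {e : β × α // e.1 ∈ B ∧ e.2 ∈ N e.1}
  let t : ι → Finset ((β × ℕ) ⊕ (α × ℕ)) := fun e =>
    (({e.1.1} : Finset β) ×ˢ Finset.range (δ - d)).disjSum
      (({e.1.2} : Finset α) ×ˢ Finset.range Δ)
  by_cases hall : ∀ s : Finset ι, s.card ≤ (s.biUnion t).card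
  · left
    obtain ⟨f, hf, hft⟩ := (Finset.all_card_le_biUnion_card_iff_exists_injective t).1 hall
    have hl : ∀ e b i, f e = Sum.inl (b, i) → b = e.1.1 ∧ i < δ - d := by
      intro e b i hx
      have := hft e
      rw [hx] at this
      simpa [t, and_comm, eq_comm] using this
    have hr : ∀ e u i, f e = Sum.inr (u, i) → u = e.1.2 ∧ i < Δ := by
      intro e u i hx
      have := hft e
      rw [hx] at this
      simpa [t, and_comm, eq_comm] using this
    let kept : β → α → Prop := fun b u =>
      ∃ (h : b ∈ B ∧ u ∈ N b) (x : α × ℕ), f ⟨(b, u), h⟩ = Sum.inr x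
    have hkept : ∀ b ∈ B, d ≤ ((N b).filter (kept b)).card := by
      intro b hb
      have hsplit := Finset.card_filter_add_card_filter_not (s := N b) (kept b)
      have hdisc : ((N b).filter fun u => ¬ kept b u).card ≤ (Finset.range (δ - d)).card := by
        have hex : ∀ u ∈ ((N b).filter fun u => ¬ kept b u), ∃ i, i < δ - d ∧
            ∃ h : b ∈ B ∧ u ∈ N b, f ⟨(b, u), h⟩ = Sum.inl (b, i) := by
          intro u hu
          rw [Finset.mem_filter] at hu
          obtain ⟨hu, hne⟩ := hu
          rcases hfe : f ⟨(b, u), hb, hu⟩ with ⟨c, i⟩ | x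
          · obtain ⟨rfl, hi⟩ := hl _ _ _ hfe
            exact ⟨i, hi, ⟨hb, hu⟩, hfe⟩
          · exact absurd ⟨⟨hb, hu⟩, x, hfe⟩ hne
        choose! g hg using hex
        refine Finset.card_le_card_of_injOn g (fun u hu => Finset.mem_coe.2
          (Finset.mem_range.2 (hg u hu).1)) ?_
        intro u hu v hv huv
        obtain ⟨-, h₁, e₁⟩ := hg u hu
        obtain ⟨-, h₂, e₂⟩ := hg v hv
        rw [huv, ← e₂] at e₁
        simpa using congrArg (fun e => e.1.2) (hf e₁)
      rw [hN b hb] at hsplit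
      rw [Finset.card_range] at hdisc
      omega
    obtain ⟨N', hN'⟩ := exists_subset_card_eq_of_le B (fun b => (N b).filter (kept b)) d hkept
    refine ⟨N', fun b hb => ⟨(hN' b hb).1.trans (Finset.filter_subset _ _), (hN' b hb).2⟩, ?_⟩
    intro u
    have hex : ∀ b ∈ B.filter (fun b => u ∈ N' b), ∃ i, i < Δ ∧ ∃ h : b ∈ B ∧ u ∈ N b,
        f ⟨(b, u), h⟩ = Sum.inr (u, i) := by
      intro b hb
      rw [Finset.mem_filter] at hb
      obtain ⟨-, h, ⟨v, i⟩, hx⟩ := Finset.mem_filter.1 ((hN' b hb.1).1 hb.2)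
      obtain ⟨rfl, hi⟩ := hr _ _ _ hx
      exact ⟨i, hi, h, hx⟩
    choose! g hg using hex
    rw [← Finset.card_range Δ]
    refine Finset.card_le_card_of_injOn g (fun b hb => Finset.mem_coe.2
      (Finset.mem_range.2 (hg b hb).1)) ?_
    intro b hb c hc hbc
    obtain ⟨-, h₁, e₁⟩ := hg b hb
    obtain ⟨-, h₂, e₂⟩ := hg c hc
    rw [hbc, ← e₂] at e₁
    simpa using congrArg (fun e => e.1.1) (hf e₁)
  · right
    push Not at hall
    obtain ⟨s, hs⟩ := hall
    let S := s.image fun e => e.1.2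
    let T₀ := s.image fun e => e.1.1
    have hsub : (T₀ ×ˢ Finset.range (δ - d)).disjSum (S ×ˢ Finset.range Δ) ⊆ s.biUnion t := by
      intro x hx
      rcases x with ⟨b, i⟩ | ⟨u, i⟩
      · simp only [Finset.inl_mem_disjSum, Finset.mem_product, T₀, Finset.mem_image] at hx
        obtain ⟨⟨e, he, rfl⟩, hi⟩ := hx
        exact Finset.mem_biUnion.2 ⟨e, he, by simpa [t] using hi⟩
      · simp only [Finset.inr_mem_disjSum, Finset.mem_product, S, Finset.mem_image] at hx
        obtain ⟨⟨e, he, rfl⟩, hi⟩ := hx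
        exact Finset.mem_biUnion.2 ⟨e, he, by simpa [t] using hi⟩
    have hcard : T₀.card * (δ - d) + S.card * Δ < s.card := by
      have := (Finset.card_le_card hsub).trans_lt hs
      simpa [Finset.card_disjSum, Finset.card_product] using this
    have hT₀B : T₀ ⊆ B := by
      intro b hb
      obtain ⟨e, -, rfl⟩ := Finset.mem_image.1 hb
      exact e.2.1
    have hcount : s.card ≤ ∑ b ∈ T₀, (N b ∩ S).card := by
      rw [← Finset.card_sigma]
      refine Finset.card_le_card_of_injOn (fun e => ⟨e.1.1, e.1.2⟩) ?_ ?_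
      · intro e he
        have he' : e ∈ s := he
        simp only [Finset.coe_sigma, Set.mem_sigma_iff, Finset.mem_coe, Finset.mem_inter]
        exact ⟨Finset.mem_image_of_mem _ he', e.2.2, Finset.mem_image_of_mem _ he'⟩
      · intro e _ e' _ hee
        simp only [Sigma.mk.injEq, heq_eq_eq] at hee
        exact Subtype.ext (Prod.ext hee.1 hee.2)
    let T := T₀.filter fun b => δ - d + 1 ≤ (N b ∩ S).card
    have hle : ∑ b ∈ T₀, (N b ∩ S).card ≤ T₀.card * (δ - d) + T.card * d := by
      have hT : T.card * d = ∑ b ∈ T₀, if δ - d + 1 ≤ (N b ∩ S).card then d else 0 := by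
        rw [← Finset.sum_filter, Finset.sum_const, smul_eq_mul]
      rw [hT, ← smul_eq_mul, ← Finset.sum_const, ← Finset.sum_add_distrib]
      refine Finset.sum_le_sum fun b hb => ?_
      have h1 := hN b (hT₀B hb)
      have h2 := Finset.card_le_card (Finset.inter_subset_left (s₁ := N b) (s₂ := S))
      split_ifs <;> omega
    refine ⟨S, T, ?_, ?_, (Finset.filter_subset _ _).trans hT₀B,
      fun b hb => (Finset.mem_filter.1 hb).2, ?_⟩
    · have : s.Nonempty := Finset.card_pos.1 (by omega)
      exact this.image _
    · intro u hu
      obtain ⟨e, -, rfl⟩ := Finset.mem_image.1 hu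
      exact ⟨e.1.1, e.2⟩
    · rw [mul_comm Δ, mul_comm d]
      omega

/-- The combinatorial core: vertices of `B` of degree `δ ≥ k (d - 1)`, vertices of `A` of degree
at most `2 ^ k * |B| / |A|`. -/
lemma exists_four_almost_biregular_selection {α β : Type*} [DecidableEq α] {d : ℕ}
    (hd : 2 ≤ d) (k : ℕ) :
    ∀ (δ : ℕ) (A : Finset α) (B : Finset β) (N : β → Finset α), d ≤ δ → k * (d - 1) ≤ δ →
      A.Nonempty → A.card ≤ B.card → (∀ b ∈ B, N b ⊆ A ∧ (N b).card = δ) →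
      (∀ u ∈ A, A.card * (B.filter fun b => u ∈ N b).card ≤ 2 ^ k * B.card) →
      ∃ (A' : Finset α) (B' : Finset β) (N' : β → Finset α), A' ⊆ A ∧ B' ⊆ B ∧ A'.Nonempty ∧
        A'.card ≤ B'.card ∧ (∀ b ∈ B', N' b ⊆ N b ∧ N' b ⊆ A' ∧ (N' b).card = d) ∧
        ∀ u ∈ A', A'.card * (B'.filter fun b => u ∈ N' b).card ≤ 4 * d * B'.card := by
  have base : ∀ (k δ : ℕ) (A : Finset α) (B : Finset β) (N : β → Finset α), d ≤ δ →
      2 ^ k ≤ 4 * d → (∀ b ∈ B, N b ⊆ A ∧ (N b).card = δ) →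
      (∀ u ∈ A, A.card * (B.filter fun b => u ∈ N b).card ≤ 2 ^ k * B.card) →
      ∃ N' : β → Finset α, (∀ b ∈ B, N' b ⊆ N b ∧ N' b ⊆ A ∧ (N' b).card = d) ∧
        ∀ u ∈ A, A.card * (B.filter fun b => u ∈ N' b).card ≤ 4 * d * B.card := by
    intro k δ A B N hdδ hk hN hdeg
    obtain ⟨N', hN'⟩ := exists_subset_card_eq_of_le B N d fun b hb => by
      rw [(hN b hb).2]
      exact hdδ
    refine ⟨N', fun b hb => ⟨(hN' b hb).1, (hN' b hb).1.trans (hN b hb).1, (hN' b hb).2⟩,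
      fun u hu => ?_⟩
    calc _ ≤ A.card * (B.filter fun b => u ∈ N b).card :=
          Nat.mul_le_mul_left _ (card_filter_mem_mono subset_rfl (fun b hb => (hN' b hb).1) u)
      _ ≤ 2 ^ k * B.card := hdeg u hu
      _ ≤ _ := Nat.mul_le_mul_right _ hk
  induction k with
  | zero =>
    intro δ A B N hdδ _ hA hAB hN hdeg
    obtain ⟨N', hN'⟩ := base 0 δ A B N hdδ (by omega) hN hdeg
    exact ⟨A, B, N', subset_rfl, subset_rfl, hA, hAB, hN'⟩
  | succ k ih =>
    intro δ A B N hdδ hkδ hA hAB hN hdeg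
    by_cases hk : 2 ^ (k + 1) ≤ 4 * d
    · obtain ⟨N', hN'⟩ := base (k + 1) δ A B N hdδ hk hN hdeg
      exact ⟨A, B, N', subset_rfl, subset_rfl, hA, hAB, hN'⟩
    have hk3 : 3 ≤ k := by
      by_contra hlt
      have : 2 ^ (k + 1) ≤ 2 ^ 3 := Nat.pow_le_pow_right (by norm_num) (by omega)
      omega
    have hkmul : k * (d - 1) + (d - 1) ≤ δ := by rw [← Nat.succ_mul]; exact hkδ
    have hk3d : 3 * (d - 1) ≤ k * (d - 1) := Nat.mul_le_mul_right _ hk3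
    have hApos := hA.card_pos
    rcases exists_bounded_selection_or_dense_subset B N (4 * d * B.card / A.card) hdδ
      (fun b hb => (hN b hb).2) with ⟨N', hN', hΔ⟩ | ⟨S, T, hS, hSN, hTB, hT, hΔ⟩
    · refine ⟨A, B, N', subset_rfl, subset_rfl, hA, hAB,
        fun b hb => ⟨(hN' b hb).1, (hN' b hb).1.trans (hN b hb).1, (hN' b hb).2⟩, fun u _ => ?_⟩
      exact (Nat.mul_le_mul_left _ (hΔ u)).trans (Nat.mul_div_le _ _)
    have hSA : S ⊆ A := fun u hu => by
      obtain ⟨b, hb, hub⟩ := hSN u hu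
      exact (hN b hb).1 hub
    have hdens : 2 * B.card * S.card ≤ A.card * T.card := by
      have hfloor : 2 * d * B.card ≤ A.card * (4 * d * B.card / A.card) := by
        have h1 := Nat.div_add_mod (4 * d * B.card) A.card
        have h2 := Nat.mod_lt (4 * d * B.card) hApos
        have h3 : 1 * B.card ≤ d * B.card := Nat.mul_le_mul_right _ (by omega)
        have h4 : 4 * d * B.card = 4 * (d * B.card) := by ring
        have h5 : 2 * d * B.card = 2 * (d * B.card) := by ring
        omega
      refine Nat.le_of_mul_le_mul_left (c := d) ?_ (by omega)
      calc d * (2 * B.card * S.card) = 2 * d * B.card * S.card := by ring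
        _ ≤ A.card * (4 * d * B.card / A.card) * S.card := Nat.mul_le_mul_right _ hfloor
        _ = A.card * (4 * d * B.card / A.card * S.card) := by ring
        _ ≤ A.card * (d * T.card) := Nat.mul_le_mul_left _ hΔ.le
        _ = _ := by ring
    have hST : S.card ≤ T.card := by
      refine Nat.le_of_mul_le_mul_left (c := A.card) ?_ hApos
      calc A.card * S.card ≤ 2 * B.card * S.card := Nat.mul_le_mul_right _ (by omega)
        _ ≤ _ := hdens
    obtain ⟨M, hM⟩ := exists_subset_card_eq_of_le T (fun b => N b ∩ S) (δ - (d - 1))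
      fun b hb => by have := hT b hb; omega
    have hMN : ∀ b ∈ T, M b ⊆ N b := fun b hb => (hM b hb).1.trans Finset.inter_subset_left
    obtain ⟨A', B', N', hA', hB', hne, hle, hsel, hdeg'⟩ :=
      ih (δ - (d - 1)) S T M (by omega) (by omega) hS hST
      (fun b hb => ⟨(hM b hb).1.trans Finset.inter_subset_right, (hM b hb).2⟩) (fun u hu => by
        refine Nat.le_of_mul_le_mul_left (c := A.card) ?_ hApos
        calc A.card * (S.card * (T.filter fun b => u ∈ M b).card)
            = S.card * (A.card * (T.filter fun b => u ∈ M b).card) := by ring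
          _ ≤ S.card * (A.card * (B.filter fun b => u ∈ N b).card) := by
            exact Nat.mul_le_mul_left _ (Nat.mul_le_mul_left _ (card_filter_mem_mono hTB hMN u))
          _ ≤ S.card * (2 ^ (k + 1) * B.card) := Nat.mul_le_mul_left _ (hdeg u (hSA hu))
          _ = 2 ^ k * (2 * B.card * S.card) := by ring
          _ ≤ 2 ^ k * (A.card * T.card) := Nat.mul_le_mul_left _ hdens
          _ = _ := by ring)
    exact ⟨A', B', N', hA'.trans hSA, hB'.trans hTB, hne, hle,
      fun b hb => ⟨(hsel b hb).1.trans (hMN b (hB' hb)), (hsel b hb).2⟩, hdeg'⟩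

/-- In a bipartite graph whose part `B` is `d`-regular, the number of edges is `d * |B|`. -/
lemma ncard_edgeSet_of_deg_eq {V : Type*} [Fintype V] (G : SimpleGraph V) {A B : Set V} {d : ℕ}
    (hdisj : Disjoint A B)
    (hadj : ∀ ⦃u v : V⦄, G.Adj u v → (u ∈ A ∧ v ∈ B) ∨ (u ∈ B ∧ v ∈ A))
    (hdeg : ∀ v ∈ B, deg G v = d) : edgeCount G = d * B.ncard := by
  classical
  have hG : G.IsBipartiteWith (A.toFinset : Set V) (B.toFinset : Set V) := by
    simpa using (⟨hdisj, hadj⟩ : G.IsBipartiteWith A B)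
  have hsum := SimpleGraph.isBipartiteWith_sum_degrees_eq_card_edges' hG
  have hconst : ∀ v ∈ B.toFinset, G.degree v = d := by
    intro v hv
    rw [← hdeg v (Set.mem_toFinset.1 hv), deg, Set.ncard_eq_toFinset_card',
      SimpleGraph.degree, SimpleGraph.neighborFinset]
  rw [Finset.sum_congr rfl hconst, Finset.sum_const, smul_eq_mul] at hsum
  rw [edgeCount, Set.ncard_eq_toFinset_card', Set.ncard_eq_toFinset_card' B, mul_comm, hsum,
    SimpleGraph.edgeFinset]

/-- A selection of neighbours for the vertices of `B` gives an almost-biregular subgraph. -/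
lemma exists_subIsAlmostBiregular_of_selection {V : Type*} [Fintype V] [DecidableEq V]
    (G : SimpleGraph V) {A B : Finset V} {N : V → Finset V} {d : ℕ}
    (hdisj : Disjoint A B) (hA : A.Nonempty) (hAB : A.card ≤ B.card)
    (hN : ∀ b ∈ B, (∀ u ∈ N b, G.Adj b u) ∧ N b ⊆ A ∧ (N b).card = d)
    {c : ℕ} (hdeg : ∀ u ∈ A, A.card * (B.filter fun b => u ∈ N b).card ≤ c * d * B.card) :
    ∃ (H : G.Subgraph) (A' B' : Set V), SubIsAlmostBiregular H A' B' c d := by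
  let H : G.Subgraph :=
    { verts := ↑A ∪ ↑B
      Adj := fun x y => (x ∈ B ∧ y ∈ N x) ∨ (y ∈ B ∧ x ∈ N y)
      adj_sub := by
        rintro x y (⟨hx, hy⟩ | ⟨hy, hx⟩)
        · exact (hN x hx).1 y hy
        · exact ((hN y hy).1 x hx).symm
      edge_vert := by
        rintro x y (⟨hx, hy⟩ | ⟨hy, hx⟩)
        · exact Or.inr hx
        · exact Or.inl ((hN y hy).2.1 hx)
      symm := ⟨fun _ _ h => h.symm⟩ }
  have hnot : ∀ x ∈ A, x ∉ B := fun _ hx => Finset.disjoint_left.1 hdisj hx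
  have hdisj' : Disjoint (A : Set V) (B : Set V) := Finset.disjoint_coe.2 hdisj
  have hadj : ∀ ⦃u v : V⦄, H.Adj u v →
      (u ∈ (A : Set V) ∧ v ∈ (B : Set V)) ∨ (u ∈ (B : Set V) ∧ v ∈ (A : Set V)) := by
    rintro x y (⟨hx, hy⟩ | ⟨hy, hx⟩)
    · exact Or.inr ⟨hx, (hN x hx).2.1 hy⟩
    · exact Or.inl ⟨(hN y hy).2.1 hx, hy⟩
  have hdegB : ∀ v ∈ (B : Set V), subDeg H v = d := by
    intro v hv
    have hv' : v ∈ B := hv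
    have : H.neighborSet v = (N v : Set V) := by
      ext u
      refine ⟨?_, fun hu => Or.inl ⟨hv', hu⟩⟩
      rintro (⟨-, hu⟩ | ⟨hu, huv⟩)
      · exact hu
      · exact absurd hv' (hnot v ((hN u hu).2.1 huv))
    rw [subDeg, this, Set.ncard_coe_finset, (hN v hv').2.2]
  have hdegA : ∀ u ∈ (A : Set V), subDeg H u = (B.filter fun b => u ∈ N b).card := by
    intro u hu
    have hu' : u ∈ A := hu
    have : H.neighborSet u = ((B.filter fun b => u ∈ N b : Finset V) : Set V) := by
      ext b
      rw [Finset.mem_coe, Finset.mem_filter]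
      refine ⟨?_, Or.inr⟩
      rintro (⟨hb, -⟩ | hb)
      · exact absurd hb (hnot u hu')
      · exact hb
    rw [subDeg, this, Set.ncard_coe_finset]
  have hedge : subEdgeCount H = d * B.card := by
    have := ncard_edgeSet_of_deg_eq H.spanningCoe hdisj' hadj hdegB
    rwa [edgeCount, SimpleGraph.Subgraph.edgeSet_spanningCoe, Set.ncard_coe_finset] at this
  have hApos : (0 : ℝ) < A.card := by exact_mod_cast hA.card_pos
  refine ⟨H, A, B, hdisj', rfl, hadj, by simpa using hA, hdegB, ?_, fun u hu => ?_⟩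
  · rw [hedge, Set.ncard_coe_finset, le_div_iff₀ hApos]
    exact_mod_cast Nat.mul_le_mul_left d hAB
  · rw [hdegA u hu, hedge, Set.ncard_coe_finset, ← mul_div_assoc, le_div_iff₀ hApos]
    have := hdeg u hu
    rw [mul_comm, mul_assoc] at this
    exact_mod_cast this

/-- If `G` is `(L, δ)`-almost-biregular, `d ≥ 2`, `δ ≥ d`, `L ≥ 1` and
`L·δ ≤ 2^⌊δ/(d-1)⌋`, then `G` has a `(4, d)`-almost-biregular subgraph. -/
theorem from_L_to_4_almost_bireg {V : Type*} [Fintype V] (G : SimpleGraph V)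
    (A B : Set V) (L : ℝ) (d δ : ℕ) (hd : 2 ≤ d) (hδ : d ≤ δ) (hL : 1 ≤ L)
    (h : IsAlmostBiregular G A B L δ)
    (hcond : L * (δ : ℝ) ≤ (2 : ℝ) ^ (δ / (d - 1))) :
    ∃ (H : G.Subgraph) (A' B' : Set V), SubIsAlmostBiregular H A' B' 4 d := by
  classical
  obtain ⟨⟨hdisj, -, hadj⟩, hAne, hdegB, hD, hdegA⟩ := h
  have hedge : edgeCount G = δ * B.toFinset.card := by
    rw [ncard_edgeSet_of_deg_eq G hdisj hadj hdegB, Set.ncard_eq_toFinset_card']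
  have hAcard : A.ncard = A.toFinset.card := Set.ncard_eq_toFinset_card' A
  have hAne' : A.toFinset.Nonempty := Set.toFinset_nonempty.2 hAne
  have hApos : (0 : ℝ) < A.toFinset.card := by exact_mod_cast hAne'.card_pos
  rw [hedge, hAcard] at hD hdegA
  have hAB : A.toFinset.card ≤ B.toFinset.card := by
    rw [le_div_iff₀ hApos] at hD
    exact Nat.le_of_mul_le_mul_left (c := δ) (by exact_mod_cast hD) (by omega)
  obtain ⟨A', B', N, hA', hB', hne, hle, hN, hdeg⟩ :=
    exists_four_almost_biregular_selection hd (δ / (d - 1)) δ A.toFinset B.toFinset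
      (fun b => (G.neighborSet b).toFinset) hδ (Nat.div_mul_le_self _ _) hAne' hAB
      (fun b hb => by
        rw [Set.mem_toFinset] at hb
        refine ⟨fun u hu => ?_, ?_⟩
        · rw [Set.mem_toFinset] at hu ⊢
          rcases hadj hu with h | h
          · exact absurd hb (Set.disjoint_left.1 hdisj h.1)
          · exact h.2
        · rw [← hdegB b hb, deg, Set.ncard_eq_toFinset_card'])
      (fun u hu => by
        have hcard : (B.toFinset.filter fun b => u ∈ (G.neighborSet b).toFinset).card ≤
            deg G u := by
          rw [deg, Set.ncard_eq_toFinset_card']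
          refine Finset.card_le_card fun b hb => ?_
          simpa [G.adj_comm] using (Finset.mem_filter.1 hb).2
        have hu' := hdegA u (Set.mem_toFinset.1 hu)
        rw [← mul_div_assoc, le_div_iff₀ hApos] at hu'
        have : (A.toFinset.card * deg G u : ℝ) ≤ 2 ^ (δ / (d - 1)) * B.toFinset.card := by
          calc (A.toFinset.card * deg G u : ℝ) = deg G u * A.toFinset.card := mul_comm _ _
            _ ≤ L * ((δ * B.toFinset.card : ℕ) : ℝ) := hu'
            _ = L * δ * B.toFinset.card := by push_cast; ring
            _ ≤ _ := by gcongr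
        exact (Nat.mul_le_mul_left _ hcard).trans (by exact_mod_cast this))
  refine exists_subIsAlmostBiregular_of_selection G (c := 4) ?_ hne hle
    (fun b hb => ⟨fun u hu => by simpa using (hN b hb).1 hu, (hN b hb).2⟩) hdeg
  exact Finset.disjoint_of_subset_left hA' (Finset.disjoint_of_subset_right hB'
    (Set.disjoint_toFinset.2 hdisj))
end

section
/- Let L ≥ 1 be a real number, let d ≥ 1 be a positive integer, and let G be an (L, d)-almost-biregular bipartite graph. Then G has a nonempty subgraph G′ with average degree at least d/2 and maximum degree at most 4·L·d. -/
variable {V : Type*}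

open Finset in
/-- A set `T` of `j ≤ |A|` vertices of `B` can be chosen greedily, with `⌈d / 2⌉` neighbours
selected for each, so that no vertex of `A` is selected more than `4 * L * d` times. -/
theorem exists_bounded_neighbor_selection {V : Type*} [DecidableEq V] (A B : Finset V)
    (r : V → V → Prop) [∀ u v, Decidable (r u v)] (L : ℝ) (d : ℕ) (hL : 1 ≤ L) (hd : 1 ≤ d)
    (hB : ∀ v ∈ B, #{u ∈ A | r u v} = d)
    (hA : ∀ u ∈ A, (#{v ∈ B | r u v} : ℝ) * #A ≤ L * (d * #B))
    (hAB : 2 * #A ≤ #B) (j : ℕ) (hj : j ≤ #A) :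
    ∃ (T : Finset V) (f : V → Finset V), T ⊆ B ∧ #T = j ∧
      (∀ v ∈ T, f v ⊆ {u ∈ A | r u v} ∧ #(f v) = (d + 1) / 2) ∧
      ∀ u ∈ A, (#{v ∈ T | u ∈ f v} : ℝ) ≤ 4 * L * d := by
  induction j with
  | zero =>
    refine ⟨∅, fun _ => ∅, by simp, by simp, by simp, fun u _ => ?_⟩
    simp only [filter_empty, card_empty, Nat.cast_zero]
    positivity
  | succ j ih =>
    obtain ⟨T, f, hTB, hTj, hf, hdeg⟩ := ih (by omega)
    have hd' : (1 : ℝ) ≤ d := by exact_mod_cast hd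
    set S := {u ∈ A | 4 * L * d < (#{v ∈ T | u ∈ f v} : ℝ) + 1} with hS
    by_cases hex : ∃ v ∈ B \ T, (d + 1) / 2 ≤ #{u ∈ A \ S | r u v}
    · obtain ⟨v, hv, hcard⟩ := hex
      rw [mem_sdiff] at hv
      obtain ⟨W, hW, hWc⟩ := exists_subset_card_eq hcard
      have hfilter : ∀ u, {w ∈ T | u ∈ Function.update f v W w} = {w ∈ T | u ∈ f w} := by
        intro u
        refine filter_congr fun w hw => ?_
        rw [Function.update_of_ne (by rintro rfl; exact hv.2 hw)]
      refine ⟨insert v T, Function.update f v W, insert_subset hv.1 hTB, ?_, ?_, ?_⟩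
      · rw [card_insert_of_notMem hv.2, hTj]
      · intro w hw
        rcases mem_insert.1 hw with rfl | hwT
        · rw [Function.update_self]
          exact ⟨hW.trans (filter_subset_filter _ sdiff_subset), hWc⟩
        · rw [Function.update_of_ne (by rintro rfl; exact hv.2 hwT)]
          exact hf w hwT
      · intro u hu
        rw [filter_insert, hfilter, Function.update_self]
        split_ifs with huW
        · have h1 := hW huW
          simp only [hS, mem_filter, mem_sdiff, not_and, not_lt] at h1
          rw [card_insert_of_notMem (by simp [hv.2])]
          push_cast
          exact h1.1.2 hu
        · exact hdeg u hu
    · exfalso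
      push Not at hex
      have hsat : ∀ v ∈ B \ T, d + 1 ≤ 2 * #{u ∈ S | r u v} := by
        intro v hv
        have h1 := hex v hv
        have h2 := hB v (mem_sdiff.1 hv).1
        have h3 : #{u ∈ A | r u v} ≤ #{u ∈ A \ S | r u v} + #{u ∈ S | r u v} := by
          refine (card_le_card ?_).trans (card_union_le _ _)
          intro u hu
          simp only [mem_filter, mem_union, mem_sdiff] at hu ⊢
          tauto
        omega
      have hsel : ∑ u ∈ S, #{v ∈ T | u ∈ f v} ≤ #T * ((d + 1) / 2) := by
        rw [← smul_eq_mul, ← sum_const]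
        refine (sum_card_bipartiteAbove_eq_sum_card_bipartiteBelow
          (s := S) (t := T) (fun u v => u ∈ f v)).trans_le (sum_le_sum fun v hv => ?_)
        rw [← (hf v hv).2]
        refine card_le_card fun u hu => ?_
        simpa using (mem_filter.1 hu).2
      have hinc : ∑ v ∈ B \ T, #{u ∈ S | r u v} ≤ ∑ u ∈ S, #{v ∈ B | r u v} := by
        refine (sum_card_bipartiteAbove_eq_sum_card_bipartiteBelow
          (s := S) (t := B \ T) r).symm.trans_le (sum_le_sum fun u _ => ?_)
        exact card_le_card (filter_subset_filter _ sdiff_subset)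
      have hselR : (#S : ℝ) * (3 * L * d) ≤ j * ((d + 1) / 2) := by
        calc (#S : ℝ) * (3 * L * d) = ∑ _u ∈ S, 3 * L * d := by
              rw [sum_const, nsmul_eq_mul]
          _ ≤ ∑ u ∈ S, (#{v ∈ T | u ∈ f v} : ℝ) := by
              refine sum_le_sum fun u hu => ?_
              have := (mem_filter.1 hu).2
              nlinarith
          _ ≤ (#T * ((d + 1) / 2 : ℕ) : ℝ) := by exact_mod_cast hsel
          _ ≤ j * ((d + 1) / 2) := by
              rw [hTj]
              gcongr
              exact_mod_cast (Nat.cast_div_le (α := ℝ) (m := d + 1) (n := 2))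
      have hcardBT : (#(B \ T) : ℝ) = #B - j := by
        rw [card_sdiff_of_subset hTB, Nat.cast_sub (card_le_card hTB), hTj]
      have hincR : ((#B : ℝ) - j) * ((d + 1) / 2) * #A ≤ #S * (L * (d * #B)) := by
        calc ((#B : ℝ) - j) * ((d + 1) / 2) * #A
            = (∑ _v ∈ B \ T, ((d : ℝ) + 1) / 2) * #A := by
              rw [sum_const, nsmul_eq_mul, hcardBT]
          _ ≤ (∑ v ∈ B \ T, (#{u ∈ S | r u v} : ℝ)) * #A := by
              gcongr with v hv
              have : (d : ℝ) + 1 ≤ 2 * #{u ∈ S | r u v} := by exact_mod_cast hsat v hv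
              linarith
          _ ≤ (∑ u ∈ S, (#{v ∈ B | r u v} : ℝ)) * #A := by
              gcongr
              exact_mod_cast hinc
          _ = ∑ u ∈ S, (#{v ∈ B | r u v} : ℝ) * #A := sum_mul _ _ _
          _ ≤ ∑ _u ∈ S, L * (d * #B) :=
              sum_le_sum fun u hu => hA u (mem_filter.1 hu).1
          _ = #S * (L * (d * #B)) := by rw [sum_const, nsmul_eq_mul]
      have hjR : (j : ℝ) + 1 ≤ #A := by exact_mod_cast hj
      have hABR : 2 * (#A : ℝ) ≤ #B := by exact_mod_cast hAB
      have hk : (0 : ℝ) < ((d : ℝ) + 1) / 2 := by positivity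
      have hcomb : (3 * (#B - j) * #A : ℝ) * (((d : ℝ) + 1) / 2)
          ≤ (#B * j) * (((d : ℝ) + 1) / 2) := by
        have := mul_le_mul_of_nonneg_left hselR (Nat.cast_nonneg (α := ℝ) #B)
        nlinarith
      have hfin := le_of_mul_le_mul_right hcomb hk
      have hj0 : (0 : ℝ) ≤ j := Nat.cast_nonneg j
      nlinarith [mul_nonneg hj0 hj0]

theorem BipartiteWith.edgeCount_eq_sum_deg {V : Type*} [Fintype V] {G : SimpleGraph V}
    {A B : Set V} (h : BipartiteWith G A B) {B' : Finset V} (hB' : (B' : Set V) = B) :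
    edgeCount G = ∑ v ∈ B', deg G v := by
  classical
  subst hB'
  have hb : G.IsBipartiteWith (A.toFinset : Set V) (B' : Set V) := by
    rw [Set.coe_toFinset]
    exact ⟨h.1, fun u v huv => h.2.2 huv⟩
  have key := SimpleGraph.isBipartiteWith_sum_degrees_eq_card_edges' hb
  have hE : edgeCount G = G.edgeFinset.card := by
    rw [edgeCount, ← SimpleGraph.coe_edgeFinset, Set.ncard_coe_finset]
  rw [hE, ← key]
  refine Finset.sum_congr rfl fun v _ => ?_
  rw [deg, Set.ncard_eq_toFinset_card', ← SimpleGraph.neighborFinset_def,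
    SimpleGraph.card_neighborFinset_eq_degree]

/-- Every `(L, d)`-almost-biregular graph with `L ≥ 1`, `d ≥ 1` has a nonempty subgraph
with average degree at least `d/2` and maximum degree at most `4·L·d`. -/
theorem find_nearly_reg_subgraph {V : Type*} [Fintype V] (G : SimpleGraph V)
    (A B : Set V) (L : ℝ) (d : ℕ) (hL : 1 ≤ L) (hd : 1 ≤ d)
    (h : IsAlmostBiregular G A B L d) :
    ∃ H : G.Subgraph, H.verts.Nonempty ∧ (d : ℝ) / 2 ≤ subAvgDeg H ∧
      ∀ v ∈ H.verts, (subDeg H v : ℝ) ≤ 4 * L * (d : ℝ) := by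
  classical
  obtain ⟨hbip, hAne, hBdeg, hD, hAdeg⟩ := h
  obtain ⟨A, rfl⟩ : ∃ A' : Finset V, (A' : Set V) = A := ⟨A.toFinset, by simp⟩
  obtain ⟨B, rfl⟩ : ∃ B' : Finset V, (B' : Set V) = B := ⟨B.toFinset, by simp⟩
  obtain ⟨hdisj, hunion, hadj⟩ := hbip
  have hdisj' : ∀ v, v ∈ A → v ∉ B := fun v hA hB =>
    Set.disjoint_left.1 hdisj (Finset.mem_coe.2 hA) (Finset.mem_coe.2 hB)
  have hcover : ∀ v, v ∈ A ∨ v ∈ B := fun v => by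
    have : v ∈ (A : Set V) ∪ B := hunion ▸ Set.mem_univ v
    simpa using this
  have hadj' : ∀ {u v}, G.Adj u v → (u ∈ A ∧ v ∈ B) ∨ (u ∈ B ∧ v ∈ A) := fun huv => by
    simpa using hadj huv
  rw [Set.ncard_coe_finset] at hD
  simp only [Set.ncard_coe_finset, Finset.mem_coe] at hAdeg hBdeg
  have hm : (0 : ℝ) < A.card := by
    exact_mod_cast Finset.card_pos.2 (Finset.coe_nonempty.1 hAne)
  have hd0 : (1 : ℝ) ≤ d := by exact_mod_cast hd
  have hLd : (d : ℝ) ≤ L * d := by nlinarith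
  have he : (edgeCount G : ℝ) = d * B.card := by
    rw [BipartiteWith.edgeCount_eq_sum_deg ⟨hdisj, hunion, hadj⟩ rfl, Finset.sum_congr rfl hBdeg,
      Finset.sum_const, smul_eq_mul]
    push_cast
    ring
  rw [he] at hD
  rw [he] at hAdeg
  have hAB : (A.card : ℝ) ≤ B.card := by
    rw [le_div_iff₀ hm] at hD
    nlinarith
  by_cases hsmall : 2 * A.card ≤ B.card
  · have hBcount : ∀ v ∈ B, (A.filter fun u => G.Adj u v).card = d := by
      intro v hv
      rw [← hBdeg v hv, deg, ← Set.ncard_coe_finset]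
      congr 1
      ext u
      simp only [Finset.coe_filter, Set.mem_ofPred_eq, SimpleGraph.mem_neighborSet]
      refine ⟨fun h => h.2.symm, fun h => ⟨?_, h.symm⟩⟩
      have := hadj' h
      have := hdisj' v
      tauto
    have hAcount : ∀ u ∈ A, ((B.filter fun v => G.Adj u v).card : ℝ) * A.card
        ≤ L * (d * B.card) := by
      intro u hu
      have h1 : (B.filter fun v => G.Adj u v).card ≤ deg G u := by
        rw [deg, ← Set.ncard_coe_finset]
        exact Set.ncard_le_ncard (fun v hv => by simpa using (Finset.mem_filter.1 hv).2)
      have h2 := hAdeg u hu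
      rw [← mul_div_assoc, le_div_iff₀ hm] at h2
      refine le_trans ?_ h2
      gcongr
    obtain ⟨T, f, hTB, hTc, hf, hTdeg⟩ := exists_bounded_neighbor_selection A B G.Adj L d hL hd
      hBcount hAcount hsmall A.card le_rfl
    have hfA : ∀ {u v}, v ∈ T → u ∈ f v → u ∈ A ∧ G.Adj u v := fun hv hu => by
      simpa using (hf _ hv).1 hu
    let H : G.Subgraph :=
      { verts := ↑(A ∪ T)
        Adj := fun u v => (v ∈ T ∧ u ∈ f v) ∨ (u ∈ T ∧ v ∈ f u)
        adj_sub := by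
          rintro u v (⟨hv, hu⟩ | ⟨hu, hv⟩)
          · exact (hfA hv hu).2
          · exact (hfA hu hv).2.symm
        edge_vert := by
          rintro u v (⟨hv, hu⟩ | ⟨hu, hv⟩)
          · simp [(hfA hv hu).1]
          · simp [hu]
        symm := ⟨fun u v h => Or.symm h⟩ }
    have hHT : ∀ v ∈ T, subDeg H v = (d + 1) / 2 := by
      intro v hv
      rw [← (hf v hv).2, subDeg, ← Set.ncard_coe_finset]
      congr 1
      ext u
      change ((u ∈ T ∧ v ∈ f u) ∨ (v ∈ T ∧ u ∈ f v)) ↔ u ∈ f v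
      refine ⟨?_, fun hu => Or.inr ⟨hv, hu⟩⟩
      rintro (⟨hu, hvu⟩ | hu)
      · exact absurd (hTB hv) (hdisj' v (hfA hu hvu).1)
      · exact hu.2
    have hHA : ∀ u ∈ A, subDeg H u = (T.filter fun v => u ∈ f v).card := by
      intro u hu
      rw [subDeg, ← Set.ncard_coe_finset]
      congr 1
      ext v
      simp only [Finset.coe_filter, Set.mem_ofPred_eq]
      change ((v ∈ T ∧ u ∈ f v) ∨ (u ∈ T ∧ v ∈ f u)) ↔ v ∈ T ∧ u ∈ f v
      refine ⟨?_, Or.inl⟩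
      rintro (hv | hv)
      · exact hv
      · exact absurd (hTB hv.1) (hdisj' u hu)
    have hHbip : BipartiteWith H.spanningCoe A B :=
      ⟨hdisj, hunion, fun u v huv => hadj (H.adj_sub huv)⟩
    have hHe : A.card * ((d + 1) / 2) ≤ subEdgeCount H := by
      have h1 : subEdgeCount H = ∑ v ∈ B, subDeg H v := hHbip.edgeCount_eq_sum_deg rfl
      rw [h1, ← hTc, ← smul_eq_mul, ← Finset.sum_const]
      refine le_trans (Finset.sum_le_sum fun v hv => (hHT v hv).ge) ?_
      exact Finset.sum_le_sum_of_subset hTB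
    have hHv : H.verts.ncard = 2 * A.card := by
      change ((A ∪ T : Finset V) : Set V).ncard = _
      rw [Set.ncard_coe_finset, Finset.card_union_of_disjoint, hTc, two_mul]
      exact Finset.disjoint_left.2 fun v hA hT => hdisj' v hA (hTB hT)
    refine ⟨H, ?_, ?_, ?_⟩
    · obtain ⟨a, ha⟩ := hAne
      exact ⟨a, Finset.mem_coe.2 (Finset.mem_union_left _ ha)⟩
    · rw [subAvgDeg, hHv, le_div_iff₀ (by push_cast; linarith)]
      have h1 : (A.card : ℝ) * ((d + 1) / 2 : ℕ) ≤ subEdgeCount H := by exact_mod_cast hHe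
      have h2 : (d : ℝ) ≤ 2 * ((d + 1) / 2 : ℕ) := by
        exact_mod_cast (by omega : d ≤ 2 * ((d + 1) / 2))
      push_cast
      nlinarith
    · intro v hv
      rcases Finset.mem_union.1 (Finset.mem_coe.1 hv) with hA | hT
      · rw [hHA v hA]
        exact hTdeg v hA
      · rw [hHT v hT]
        have : (((d + 1) / 2 : ℕ) : ℝ) ≤ d := by
          exact_mod_cast (by omega : (d + 1) / 2 ≤ d)
        linarith
  · have hsmall' : (B.card : ℝ) < 2 * A.card := by exact_mod_cast not_le.1 hsmall
    have hcard : Fintype.card V = A.card + B.card := by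
      rw [← Finset.card_univ, ← Finset.card_union_of_disjoint (Finset.disjoint_coe.1 hdisj)]
      congr 1
      ext v
      simpa using hcover v
    refine ⟨⊤, ?_, ?_, ?_⟩
    · exact hAne.mono (Set.subset_univ _)
    · have h1 : subEdgeCount (⊤ : G.Subgraph) = edgeCount G := by
        rw [subEdgeCount, edgeCount, SimpleGraph.Subgraph.edgeSet_top]
      rw [subAvgDeg, h1, he, SimpleGraph.Subgraph.verts_top, Set.ncard_univ,
        Nat.card_eq_fintype_card, hcard]
      push_cast
      rw [le_div_iff₀ (by linarith)]
      nlinarith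
    · intro v _
      have h1 : subDeg (⊤ : G.Subgraph) v = deg G v := by
        rw [subDeg, deg, SimpleGraph.Subgraph.neighborSet_top]
      rw [h1]
      rcases hcover v with hA | hB
      · refine (hAdeg v hA).trans ?_
        have : (d : ℝ) * B.card / A.card ≤ 2 * d := by
          rw [div_le_iff₀ hm]
          nlinarith
        nlinarith
      · rw [hBdeg v hB]
        linarith
end

section
/- There exists an absolute constant r₀ such that the following holds for all integers r ≥ r₀. Let k and Δ be positive integers with Δ ≥ 4, and let G be a K_{k,k}-free graph with maximum degree at most Δ and average degree at least 80r²·log₂ log₂ Δ. Then G has a 64-almost-regular subgraph with average degree at least r/(160(k+1)·log₂ r). -/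
variable {V : Type*}

namespace AlmostRegular
open Finset

open scoped Classical in
/-- `N` restricted to `B`, viewed as a bipartite graph, has a nonempty set of edges `F` whose
degrees are at most `M` and whose average degree is at least `M / 32`. -/
def HasDenseSub {α β : Type*} (N : β → Finset α) (B : Finset β) (M : ℕ) : Prop :=
  ∃ F : Finset (α × β), F.Nonempty ∧ (∀ p ∈ F, p.2 ∈ B ∧ p.1 ∈ N p.2) ∧
    (∀ u, #{p ∈ F | p.1 = u} ≤ M) ∧ (∀ b, #{p ∈ F | p.2 = b} ≤ M) ∧
    M * (#(F.image Prod.fst) + #(F.image Prod.snd)) ≤ 64 * #F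

section
open scoped Classical
variable {α β : Type*}

lemma HasDenseSub.mono {N N' : β → Finset α} {B B' : Finset β} {M : ℕ} (hB : B ⊆ B')
    (hN : ∀ b ∈ B, N b ⊆ N' b) (h : HasDenseSub N B M) : HasDenseSub N' B' M := by
  obtain ⟨F, h1, h2, h3⟩ := h
  exact ⟨F, h1, fun p hp => ⟨hB (h2 p hp).1, hN _ (h2 p hp).1 (h2 p hp).2⟩, h3⟩

lemma hasDenseSub_of_subfamily {N N' : β → Finset α} {A : Finset α} {B B' : Finset β} {M : ℕ}
    (hB : B' ⊆ B) (hN : ∀ b ∈ B', N' b ⊆ N b) (hc : ∀ b ∈ B', #(N' b) ≤ M)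
    (hu : ∀ u, #{b ∈ B' | u ∈ N' b} ≤ M)
    (hne : {p ∈ A ×ˢ B' | p.1 ∈ N' p.2}.Nonempty)
    (hcard : M * (#A + #B') ≤ 64 * #{p ∈ A ×ˢ B' | p.1 ∈ N' p.2}) :
    HasDenseSub N B M := by
  refine ⟨_, hne, fun p hp => ?_, fun u => ?_, fun b => ?_, le_trans ?_ hcard⟩
  · simp only [mem_filter, mem_product] at hp
    exact ⟨hB hp.1.2, hN _ hp.1.2 hp.2⟩
  · refine le_trans (card_le_card_of_injOn Prod.snd ?_ ?_) (hu u)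
    · rintro ⟨a, b⟩ hp
      simp only [coe_filter, mem_filter, mem_product, Set.mem_ofPred_eq] at hp ⊢
      obtain ⟨⟨⟨_, h1⟩, h2⟩, rfl⟩ := hp
      exact ⟨h1, h2⟩
    · rintro ⟨a, b⟩ hp ⟨a', b'⟩ hp' h
      simp only [coe_filter, mem_filter, mem_product, Set.mem_ofPred_eq] at hp hp' h
      simp [hp.2, hp'.2, h]
  · by_cases hb : b ∈ B'
    · refine le_trans (card_le_card_of_injOn Prod.fst ?_ ?_) (hc b hb)
      · rintro ⟨a, b⟩ hp
        simp only [coe_filter, mem_filter, mem_product, Set.mem_ofPred_eq] at hp ⊢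
        obtain ⟨⟨⟨_, h1⟩, h2⟩, rfl⟩ := hp
        exact h2
      · rintro ⟨a, b⟩ hp ⟨a', b'⟩ hp' h
        simp only [coe_filter, mem_filter, mem_product, Set.mem_ofPred_eq] at hp hp' h
        simp [hp.2, hp'.2, h]
    · rw [filter_eq_empty_iff.2]
      · simp
      · rintro ⟨a, b'⟩ hp rfl
        simp only [mem_filter, mem_product] at hp
        exact hb hp.1.2
  · gcongr
    · intro x
      simp only [mem_image, mem_filter, mem_product]
      rintro ⟨p, h, rfl⟩
      exact h.1.1
    · intro x
      simp only [mem_image, mem_filter, mem_product]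
      rintro ⟨p, h, rfl⟩
      exact h.1.2

lemma card_filter_product_eq_sum_right (A : Finset α) (B : Finset β) (N : β → Finset α)
    (hN : ∀ b ∈ B, N b ⊆ A) :
    #{p ∈ A ×ˢ B | p.1 ∈ N p.2} = ∑ b ∈ B, #(N b) := by
  rw [card_filter, sum_product_right]
  refine sum_congr rfl fun b hb => ?_
  rw [← card_filter]
  exact congrArg card ((filter_mem_eq_inter (s := A) (t := N b)).trans (inter_eq_right.2 (hN b hb)))

lemma card_filter_product_eq_sum_left (A : Finset α) (B : Finset β) (N : β → Finset α) :
    #{p ∈ A ×ˢ B | p.1 ∈ N p.2} = ∑ u ∈ A, #{b ∈ B | u ∈ N b} := by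
  rw [card_filter, sum_product]
  exact sum_congr rfl fun b hb => (card_filter _ _).symm

lemma sum_card_inter_eq (A : Finset α) (B : Finset β) (N : β → Finset α) :
    ∑ b ∈ B, #(N b ∩ A) = ∑ u ∈ A, #{b ∈ B | u ∈ N b} := by
  rw [← card_filter_product_eq_sum_left,
    ← card_filter_product_eq_sum_right A B (fun b => N b ∩ A) fun b _ => inter_subset_right]
  congr 1
  ext p
  simp only [mem_filter, mem_product, mem_inter]
  tauto

/-- A greedily chosen subfamily of `M`-sets in which every vertex has degree at most `M`, and which
cannot be extended. -/
lemma exists_greedy (N : β → Finset α) (A : Finset α) (B : Finset β) (M : ℕ) :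
    ∃ (B' : Finset β) (N' : β → Finset α), B' ⊆ B ∧
      (∀ b ∈ B', N' b ⊆ N b ∩ A ∧ #(N' b) = M) ∧ (∀ u, #{b ∈ B' | u ∈ N' b} ≤ M) ∧
      ∀ b ∈ B \ B', #{u ∈ N b ∩ A | #{b' ∈ B' | u ∈ N' b'} < M} < M := by
  induction B using Finset.induction_on with
  | empty => exact ⟨∅, fun _ => ∅, by simp⟩
  | insert b B hb ih =>
    obtain ⟨B', N', h1, h2, h3, h4⟩ := ih
    by_cases h : #{u ∈ N b ∩ A | #{b' ∈ B' | u ∈ N' b'} < M} < M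
    · refine ⟨B', N', h1.trans (subset_insert _ _), h2, h3, fun c hc => ?_⟩
      rw [mem_sdiff, mem_insert] at hc
      obtain ⟨rfl | hc, hc'⟩ := hc
      · exact h
      · exact h4 c (mem_sdiff.2 ⟨hc, hc'⟩)
    · obtain ⟨Y, hY, hYc⟩ := exists_subset_card_eq (not_lt.1 h)
      have hbB' : b ∉ B' := fun h => hb (h1 h)
      have key : ∀ u, {c ∈ insert b B' | u ∈ Function.update N' b Y c} =
          if u ∈ Y then insert b {c ∈ B' | u ∈ N' c} else {c ∈ B' | u ∈ N' c} := by
        intro u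
        have : {c ∈ B' | u ∈ Function.update N' b Y c} = {c ∈ B' | u ∈ N' c} :=
          filter_congr fun c hc => by
            rw [Function.update_of_ne (ne_of_mem_of_not_mem hc hbB')]
        rw [filter_insert, this, Function.update_self]
      refine ⟨insert b B', Function.update N' b Y, insert_subset_insert _ h1, fun c hc => ?_,
        fun u => ?_, fun c hc => ?_⟩
      · rw [mem_insert] at hc
        obtain rfl | hc := hc
        · simp only [Function.update_self]
          exact ⟨hY.trans (filter_subset _ _), hYc⟩
        · rw [Function.update_of_ne (ne_of_mem_of_not_mem hc hbB')]
          exact h2 c hc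
      · rw [key]
        split_ifs with hu
        · have := (mem_filter.1 (hY hu)).2
          exact (card_insert_le _ _).trans this
        · exact h3 u
      · rw [mem_sdiff, mem_insert, mem_insert, not_or] at hc
        refine lt_of_le_of_lt (card_le_card ?_)
          (h4 c (mem_sdiff.2 ⟨hc.1.resolve_left hc.2.1, hc.2.2⟩))
        refine monotone_filter_right _ fun u _ hu => lt_of_le_of_lt (card_le_card ?_) hu
        rw [key]
        split_ifs
        · exact subset_insert _ _
        · exact subset_rfl

lemma exists_saturated {N : β → Finset α} {B : Finset β} {M : ℕ} (hM : 1 ≤ M)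
    (h : ¬ HasDenseSub N B M) (A : Finset α) :
    ∃ B' ⊆ B, ∃ S ⊆ A, 63 * #S ≤ #B' ∧ 63 * #B' ≤ #A ∧
      ∀ b ∈ B \ B', #(N b ∩ A) ≤ #(N b ∩ S) + M := by
  obtain ⟨B', N', h1, h2, h3, h4⟩ := exists_greedy N A B M
  refine ⟨B', h1, {u ∈ A | ¬ #{b' ∈ B' | u ∈ N' b'} < M}, filter_subset _ _, ?_, ?_, ?_⟩
  · by_contra hlt
    rw [not_le] at hlt
    set S := {u ∈ A | ¬ #{b' ∈ B' | u ∈ N' b'} < M}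
    have hF : #{p ∈ S ×ˢ B' | p.1 ∈ N' p.2} = #S * M := by
      rw [card_filter_product_eq_sum_left]
      refine sum_const_nat fun u hu => le_antisymm (h3 u) (not_lt.1 (mem_filter.1 hu).2)
    refine h (hasDenseSub_of_subfamily (N' := N') (A := S) (B' := B') h1
      (fun b hb => (h2 b hb).1.trans inter_subset_left) (fun b hb => (h2 b hb).2.le) h3 ?_ ?_)
    · rw [← card_pos, hF]
      have : 0 < #S := by omega
      positivity
    · rw [hF]
      nlinarith
  · by_contra hlt
    rw [not_le] at hlt
    have hF : #{p ∈ A ×ˢ B' | p.1 ∈ N' p.2} = #B' * M := by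
      rw [card_filter_product_eq_sum_right]
      · exact sum_const_nat fun u hu => (h2 u hu).2
      · exact fun b hb => (h2 b hb).1.trans inter_subset_right
    refine h (hasDenseSub_of_subfamily (N' := N') (A := A) (B' := B') h1
      (fun b hb => (h2 b hb).1.trans inter_subset_left) (fun b hb => (h2 b hb).2.le) h3 ?_ ?_)
    · rw [← card_pos, hF]
      have : 0 < #B' := by omega
      positivity
    · rw [hF]
      nlinarith
  · intro b hb
    have := h4 b hb
    rw [← card_filter_add_card_filter_not (s := N b ∩ A)
      (fun u => #{b' ∈ B' | u ∈ N' b'} < M)]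
    have h5 : {u ∈ N b ∩ A | ¬ #{b' ∈ B' | u ∈ N' b'} < M} =
        N b ∩ {u ∈ A | ¬ #{b' ∈ B' | u ∈ N' b'} < M} := by
      rw [inter_filter]
    rw [h5]
    omega

lemma exists_low {N : β → Finset α} {A : Finset α} {B : Finset β} {M d : ℕ} (hM : 1 ≤ M)
    (h : ¬ HasDenseSub N B M) (hd : ∀ b ∈ B, d ≤ #(N b ∩ A)) (hAB : #A ≤ #B)
    (hB : B.Nonempty) (i : ℕ) :
    ∃ A' ⊆ A, ∃ B' ⊆ B, B'.Nonempty ∧ 2 ^ i * #A' ≤ #B' ∧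
      ∀ b ∈ B', d ≤ #(N b ∩ A') + i * M := by
  induction i with
  | zero => exact ⟨A, subset_rfl, B, subset_rfl, hB, by simpa, by simpa⟩
  | succ i ih =>
    obtain ⟨A₁, hA₁, B₁, hB₁, hne, hc, hd₁⟩ := ih
    obtain ⟨B', hB', S, hS, h1, h2, h3⟩ := exists_saturated hM
      (fun h' => h (h'.mono hB₁ fun _ _ => subset_rfl)) A₁
    have hA₁B₁ : #A₁ ≤ #B₁ := by
      have : 1 ≤ 2 ^ i := Nat.one_le_two_pow
      nlinarith
    have hs := card_sdiff_add_card_eq_card hB'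
    have hpos := hne.card_pos
    refine ⟨S, hS.trans hA₁, B₁ \ B', sdiff_subset.trans hB₁, card_pos.1 (by omega), ?_,
      fun b hb => ?_⟩
    · have h4 : 2 ^ i * (3969 * #S) ≤ 2 ^ i * #A₁ := Nat.mul_le_mul_left _ (by omega)
      rw [pow_succ]
      have h5 : 2 ^ i * 2 * #S = 2 * (2 ^ i * #S) := by ring
      have h6 : 2 ^ i * (3969 * #S) = 3969 * (2 ^ i * #S) := by ring
      omega
    · have := h3 b hb
      have := hd₁ b (mem_sdiff.1 hb).1
      rw [add_one_mul]
      omega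

/-- The expectation of `f X`, where `X` is the random subset of `A` that contains each `u ∈ A`
independently with probability `p u`. -/
noncomputable def subsetMean (A : Finset α) (p : α → ℝ) (f : Finset α → ℝ) : ℝ :=
  ∑ X ∈ A.powerset, ((∏ u ∈ X, p u) * ∏ u ∈ A \ X, (1 - p u)) * f X

/-- The indicator of the event `S ⊆ X`. -/
noncomputable def subsetInd (S X : Finset α) : ℝ := if S ⊆ X then 1 else 0

lemma subsetInd_nonneg (S X : Finset α) : 0 ≤ subsetInd S X := by
  unfold subsetInd; split_ifs <;> norm_num

lemma subsetInd_mul (S T X : Finset α) :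
    subsetInd S X * subsetInd T X = subsetInd (S ∪ T) X := by
  unfold subsetInd
  by_cases h1 : S ⊆ X <;> by_cases h2 : T ⊆ X <;> simp [h1, h2, union_subset_iff]

lemma subsetMean_sub (A : Finset α) (p : α → ℝ) (f g : Finset α → ℝ) :
    subsetMean A p (fun X => f X - g X) = subsetMean A p f - subsetMean A p g := by
  simp [subsetMean, mul_sub]

lemma subsetMean_add (A : Finset α) (p : α → ℝ) (f g : Finset α → ℝ) :
    subsetMean A p (fun X => f X + g X) = subsetMean A p f + subsetMean A p g := by
  simp [subsetMean, mul_add, sum_add_distrib]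

lemma subsetMean_const_mul (A : Finset α) (p : α → ℝ) (c : ℝ) (f : Finset α → ℝ) :
    subsetMean A p (fun X => c * f X) = c * subsetMean A p f := by
  simp [subsetMean, mul_sum, mul_left_comm]

lemma subsetMean_sum {ι : Type*} (A : Finset α) (p : α → ℝ) (s : Finset ι)
    (f : ι → Finset α → ℝ) :
    subsetMean A p (fun X => ∑ i ∈ s, f i X) = ∑ i ∈ s, subsetMean A p (f i) := by
  simp only [subsetMean, mul_sum]
  exact sum_comm

lemma subsetMean_mono {A : Finset α} {p : α → ℝ} (hp : ∀ u ∈ A, 0 ≤ p u ∧ p u ≤ 1)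
    {f g : Finset α → ℝ} (h : ∀ X ⊆ A, f X ≤ g X) : subsetMean A p f ≤ subsetMean A p g := by
  refine sum_le_sum fun X hX => mul_le_mul_of_nonneg_left (h X (mem_powerset.1 hX)) ?_
  refine mul_nonneg (prod_nonneg fun u hu => (hp u (mem_powerset.1 hX hu)).1)
    (prod_nonneg fun u hu => ?_)
  linarith [(hp u (mem_sdiff.1 hu).1).2]

lemma subsetMean_subsetInd {A S : Finset α} (p : α → ℝ) (hS : S ⊆ A) :
    subsetMean A p (subsetInd S) = ∏ u ∈ S, p u := by
  have h := prod_add p (fun u => if u ∈ S then 0 else 1 - p u) A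
  have h1 : ∏ u ∈ A, (p u + if u ∈ S then 0 else 1 - p u) = ∏ u ∈ S, p u := by
    rw [← prod_subset hS]
    · exact prod_congr rfl fun u hu => by simp [hu]
    · intro u _ hu
      simp [hu]
  rw [← h1, h, subsetMean]
  refine sum_congr rfl fun X hX => ?_
  rw [mul_assoc]
  congr 1
  by_cases hSX : S ⊆ X
  · rw [subsetInd, if_pos hSX, mul_one]
    exact prod_congr rfl fun u hu => by
      rw [if_neg fun h => (mem_sdiff.1 hu).2 (hSX h)]
  · rw [subsetInd, if_neg hSX, mul_zero]
    obtain ⟨u, hu, huX⟩ := not_subset.1 hSX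
    exact (prod_eq_zero (f := fun u => if u ∈ S then (0 : ℝ) else 1 - p u)
      (mem_sdiff.2 ⟨hS hu, huX⟩) (if_pos hu)).symm

lemma exists_pos_of_subsetMean_pos {A : Finset α} {p : α → ℝ}
    (hp : ∀ u ∈ A, 0 ≤ p u ∧ p u ≤ 1) {f : Finset α → ℝ} (h : 0 < subsetMean A p f) :
    ∃ X ⊆ A, 0 < f X := by
  by_contra! hf
  have := subsetMean_mono hp (g := fun _ => 0) hf
  simp [subsetMean] at this h
  linarith

/-- The inverse of the probability that a random set contains `S`. -/
noncomputable def invProb (p : α → ℝ) (S : Finset α) : ℝ := ∏ u ∈ S, (p u)⁻¹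

lemma subsetMean_invProb_mul {A S : Finset α} {p : α → ℝ} (hp : ∀ u ∈ A, 0 < p u) (hS : S ⊆ A) :
    subsetMean A p (fun X => invProb p S * subsetInd S X) = 1 := by
  rw [subsetMean_const_mul, subsetMean_subsetInd p hS, invProb, ← prod_mul_distrib]
  exact prod_eq_one fun u hu => inv_mul_cancel₀ (hp u (hS hu)).ne'

lemma subsetMean_invProb_mul_mul {A S T : Finset α} {p : α → ℝ} (hp : ∀ u ∈ A, 0 < p u)
    (hS : S ⊆ A) (hT : T ⊆ A) :
    subsetMean A p (fun X => invProb p S * subsetInd S X * (invProb p T * subsetInd T X)) =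
      invProb p (S ∩ T) := by
  have h : ∀ X, invProb p S * subsetInd S X * (invProb p T * subsetInd T X) =
      invProb p (S ∩ T) * (invProb p (S ∪ T) * subsetInd (S ∪ T) X) := by
    intro X
    have h1 : invProb p (S ∪ T) * invProb p (S ∩ T) = invProb p S * invProb p T :=
      prod_union_inter
    rw [← subsetInd_mul]
    linear_combination (-subsetInd S X * subsetInd T X) * h1
  simp only [h]
  rw [subsetMean_const_mul, subsetMean_invProb_mul hp (union_subset hS hT), mul_one]

lemma invProb_le_pow {S A : Finset α} {p : α → ℝ} {P : ℝ} {t : ℕ} (hP : 1 ≤ P) (hS : S ⊆ A)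
    (hp : ∀ u ∈ A, 0 < p u ∧ (p u)⁻¹ ≤ P) (ht : #S ≤ t) : invProb p S ≤ P ^ t := by
  calc invProb p S ≤ ∏ u ∈ S, P :=
        prod_le_prod (fun u hu => (inv_pos.2 (hp u (hS hu)).1).le) fun u hu => (hp u (hS hu)).2
    _ = P ^ #S := by simp
    _ ≤ P ^ t := pow_le_pow_right₀ hP ht

/-- The weighted degree of `u` in the random induced subfamily, each member being weighted by
the inverse of its survival probability. -/
noncomputable def randDeg (N : β → Finset α) (B : Finset β) (p : α → ℝ) (u : α)
    (X : Finset α) : ℝ :=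
  ∑ b ∈ B with u ∈ N b, invProb p (N b) * subsetInd (N b) X

lemma subsetMean_randDeg {N : β → Finset α} {A : Finset α} {B : Finset β} {p : α → ℝ}
    (hN : ∀ b ∈ B, N b ⊆ A) (hp : ∀ u ∈ A, 0 < p u) (u : α) :
    subsetMean A p (randDeg N B p u) = #{b ∈ B | u ∈ N b} := by
  unfold randDeg
  rw [subsetMean_sum, sum_congr rfl fun b hb =>
    subsetMean_invProb_mul hp (hN b (mem_filter.1 hb).1)]
  simp

lemma subsetMean_randDeg_sq_le {N : β → Finset α} {A : Finset α} {B : Finset β} {p : α → ℝ}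
    {P θ : ℝ} {t : ℕ} (hP : 1 ≤ P) (hθ : 0 ≤ θ) (hN : ∀ b ∈ B, N b ⊆ A ∧ #(N b) = t)
    (hp : ∀ u ∈ A, 0 < p u ∧ (p u)⁻¹ ≤ P)
    (hco : ∀ u v, u ≠ v → (#{b ∈ B | u ∈ N b ∧ v ∈ N b} : ℝ) ≤ θ) {u : α} (hu : u ∈ A) :
    subsetMean A p (fun X => randDeg N B p u X ^ 2) ≤
      (#{b ∈ B | u ∈ N b} : ℝ) ^ 2 * (p u)⁻¹ + P ^ t * t * θ * #{b ∈ B | u ∈ N b} := by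
  set Bu := {b ∈ B | u ∈ N b} with hBu
  have hBu' : ∀ b ∈ Bu, b ∈ B ∧ u ∈ N b := fun b hb => mem_filter.1 hb
  have h1 : subsetMean A p (fun X => randDeg N B p u X ^ 2) =
      ∑ b ∈ Bu, ∑ c ∈ Bu, invProb p (N b ∩ N c) := by
    simp only [randDeg, sq, sum_mul_sum, ← hBu]
    rw [subsetMean_sum]
    refine sum_congr rfl fun b hb => ?_
    rw [subsetMean_sum]
    exact sum_congr rfl fun c hc => subsetMean_invProb_mul_mul (fun u hu => (hp u hu).1)
      (hN b (hBu' b hb).1).1 (hN c (hBu' c hc).1).1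
  have hP0 : 0 < P ^ t := by positivity
  have h2 : ∀ b ∈ Bu, ∀ c ∈ Bu, invProb p (N b ∩ N c) ≤
      (p u)⁻¹ + ∑ v ∈ (N b).erase u, if v ∈ N c then P ^ t else 0 := by
    intro b hb c hc
    have hnn : ∀ v ∈ (N b).erase u, (0 : ℝ) ≤ if v ∈ N c then P ^ t else 0 := by
      intro v _
      split_ifs <;> positivity
    by_cases h : N b ∩ N c = {u}
    · rw [h, invProb, prod_singleton]
      linarith [sum_nonneg hnn]
    · have hmem : u ∈ N b ∩ N c := mem_inter.2 ⟨(hBu' b hb).2, (hBu' c hc).2⟩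
      obtain ⟨v, hv, hvu⟩ : ∃ v ∈ N b ∩ N c, v ≠ u := by
        by_contra! h'
        exact h (eq_singleton_iff_unique_mem.2 ⟨hmem, h'⟩)
      rw [mem_inter] at hv
      have h3 := single_le_sum hnn (mem_erase.2 ⟨hvu, hv.1⟩)
      rw [if_pos hv.2] at h3
      have h4 : invProb p (N b ∩ N c) ≤ P ^ t := by
        refine invProb_le_pow hP (inter_subset_left.trans (hN b (hBu' b hb).1).1) hp ?_
        rw [← (hN b (hBu' b hb).1).2]
        exact card_le_card inter_subset_left
      have := inv_pos.2 (hp u hu).1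
      linarith
  rw [h1]
  calc ∑ b ∈ Bu, ∑ c ∈ Bu, invProb p (N b ∩ N c)
      ≤ ∑ b ∈ Bu, ∑ c ∈ Bu,
          ((p u)⁻¹ + ∑ v ∈ (N b).erase u, if v ∈ N c then P ^ t else 0) :=
        sum_le_sum fun b hb => sum_le_sum fun c hc => h2 b hb c hc
    _ ≤ ∑ b ∈ Bu, (#Bu * (p u)⁻¹ + t * (P ^ t * θ)) := by
        refine sum_le_sum fun b hb => ?_
        rw [sum_add_distrib, sum_const, nsmul_eq_mul, sum_comm]
        refine add_le_add_right ?_ _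
        have h5 : ∀ v ∈ (N b).erase u, (∑ c ∈ Bu, if v ∈ N c then P ^ t else 0) ≤ P ^ t * θ := by
          intro v hv
          rw [← sum_filter, sum_const, nsmul_eq_mul, mul_comm, hBu, filter_filter]
          exact mul_le_mul_of_nonneg_left (hco u v (mem_erase.1 hv).1.symm) hP0.le
        refine (sum_le_sum h5).trans ?_
        rw [sum_const, nsmul_eq_mul]
        refine mul_le_mul_of_nonneg_right ?_ (by positivity)
        rw [← (hN b (hBu' b hb).1).2]
        exact_mod_cast card_le_card (erase_subset _ _)
    _ = _ := by
        rw [sum_const, nsmul_eq_mul]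
        ring

lemma sum_invProb_mul_card_inter (N : β → Finset α) (B : Finset β) (p : α → ℝ)
    (X T : Finset α) :
    ∑ b ∈ B, invProb p (N b) * subsetInd (N b) X * #(N b ∩ T) =
      ∑ u ∈ T, randDeg N B p u X := by
  unfold randDeg
  simp only [sum_filter]
  rw [sum_comm]
  refine sum_congr rfl fun b _ => ?_
  rw [← sum_filter, sum_const, nsmul_eq_mul, filter_mem_eq_inter, inter_comm, mul_comm]

lemma subsetMean_card {A : Finset α} (p : α → ℝ) :
    subsetMean A p (fun X => #X) = ∑ u ∈ A, p u := by
  have h : ∀ X ∈ A.powerset, ((#X : ℕ) : ℝ) = ∑ u ∈ A, subsetInd {u} X := by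
    intro X hX
    simp only [subsetInd, singleton_subset_iff]
    rw [← sum_filter, sum_const, nsmul_eq_mul, mul_one, filter_mem_eq_inter,
      inter_eq_right.2 (mem_powerset.1 hX)]
  calc subsetMean A p (fun X => #X) = subsetMean A p (fun X => ∑ u ∈ A, subsetInd {u} X) :=
        sum_congr rfl fun X hX => by simp only [h X hX]
    _ = ∑ u ∈ A, p u := by
        rw [subsetMean_sum]
        refine sum_congr rfl fun u hu => ?_
        have := subsetMean_subsetInd p (singleton_subset_iff.2 hu)
        simpa using this

lemma randDeg_eq_zero (N : β → Finset α) (B : Finset β) (p : α → ℝ) {u : α} {X : Finset α}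
    (hu : u ∉ X) : randDeg N B p u X = 0 :=
  sum_eq_zero fun b hb => by
    rw [subsetInd, if_neg fun h => hu (h (mem_filter.1 hb).2), mul_zero]

lemma subsetMean_excess_le {N : β → Finset α} {A : Finset α} {B : Finset β} {p : α → ℝ}
    {P θ Λ : ℝ} {t : ℕ} (hP : 1 ≤ P) (hθ : 0 ≤ θ) (hΛ : 0 < Λ)
    (hN : ∀ b ∈ B, N b ⊆ A ∧ #(N b) = t) (hp : ∀ u ∈ A, 0 < p u ∧ p u ≤ 1 ∧ (p u)⁻¹ ≤ P)
    (hco : ∀ u v, u ≠ v → (#{b ∈ B | u ∈ N b ∧ v ∈ N b} : ℝ) ≤ θ) {u : α} (hu : u ∈ A)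
    (hpu : (#{b ∈ B | u ∈ N b} : ℝ) ≤ Λ * p u) :
    subsetMean A p (fun X => if 4 * Λ < randDeg N B p u X then randDeg N B p u X else 0) ≤
      P ^ t * t * θ * (#{b ∈ B | u ∈ N b} : ℝ) / Λ := by
  set dg : ℝ := (#{b ∈ B | u ∈ N b} : ℝ)
  have hdg : 0 ≤ dg := Nat.cast_nonneg _
  obtain ⟨hp0, hp1, -⟩ := hp u hu
  set m := dg * (p u)⁻¹
  have hm : m ≤ Λ := by
    change dg * (p u)⁻¹ ≤ Λ
    rw [← div_eq_mul_inv, div_le_iff₀ hp0]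
    exact hpu
  have hm0 : 0 ≤ m := by positivity
  have hsq := subsetMean_randDeg_sq_le hP hθ hN (fun u hu => ⟨(hp u hu).1, (hp u hu).2.2⟩) hco hu
  have hmean : subsetMean A p (fun X => Λ⁻¹ * (randDeg N B p u X ^ 2 -
      2 * m * randDeg N B p u X + m ^ 2 * subsetInd {u} X)) ≤
      P ^ t * t * θ * dg / Λ := by
    rw [subsetMean_const_mul, subsetMean_add, subsetMean_sub, subsetMean_const_mul,
      subsetMean_const_mul, subsetMean_subsetInd p (singleton_subset_iff.2 hu), prod_singleton,
      subsetMean_randDeg (fun b hb => (hN b hb).1) fun u hu => (hp u hu).1, div_eq_inv_mul]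
    refine mul_le_mul_of_nonneg_left ?_ (inv_pos.2 hΛ).le
    have h1 : m ^ 2 * p u = dg ^ 2 * (p u)⁻¹ := by
      simp only [m]
      field_simp
    have h2 : 2 * m * dg = 2 * (dg ^ 2 * (p u)⁻¹) := by
      simp only [m]
      ring
    change _ - 2 * m * dg + _ ≤ _
    linarith
  refine (subsetMean_mono (fun u hu => ⟨(hp u hu).1.le, (hp u hu).2.1⟩) fun X hX => ?_).trans hmean
  by_cases huX : u ∈ X
  · rw [subsetInd, if_pos (singleton_subset_iff.2 huX), mul_one, ← div_eq_inv_mul,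
      le_div_iff₀ hΛ]
    split_ifs with h
    · nlinarith [sq_nonneg (randDeg N B p u X - 4 * Λ)]
    · nlinarith [sq_nonneg (randDeg N B p u X - m)]
  · rw [randDeg_eq_zero N B p huX, if_neg (by linarith), subsetInd,
      if_neg fun h => huX (singleton_subset_iff.1 h)]
    simp

lemma weight_sub_excess_le {N : β → Finset α} {B : Finset β} {M t : ℕ} (hM : 1 ≤ M)
    (ht : t = 2 * M) (h : ¬ HasDenseSub N B M) {p : α → ℝ} {P Λ : ℝ} (hP : 0 ≤ P) (hΛ : 0 < Λ)
    (hN : ∀ b ∈ B, #(N b) = t) (hp : ∀ b ∈ B, 0 ≤ invProb p (N b) ∧ invProb p (N b) ≤ P ^ t)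
    (hPt : t * P ^ t ≤ Λ) (X : Finset α) :
    M * ∑ b ∈ B, invProb p (N b) * subsetInd (N b) X -
      ∑ u ∈ X, (if 4 * Λ < randDeg N B p u X then randDeg N B p u X else 0) ≤
        67 / 3969 * Λ * #X := by
  set w : β → ℝ := fun b => invProb p (N b) * subsetInd (N b) X with hw
  set Ag := {u ∈ X | ¬ 4 * Λ < randDeg N B p u X} with hAg
  obtain ⟨B', hB', S, hS, h1, h2, h3⟩ := exists_saturated hM
    (fun h' => h (h'.mono (filter_subset (fun b => N b ⊆ X) B) fun _ _ => subset_rfl)) Ag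
  have hw0 : ∀ b ∈ B, 0 ≤ w b := fun b hb => mul_nonneg (hp b hb).1 (subsetInd_nonneg _ _)
  have hwP : ∀ b ∈ B, w b ≤ P ^ t := by
    intro b hb
    refine (mul_le_of_le_one_right (hp b hb).1 ?_).trans (hp b hb).2
    unfold subsetInd
    split_ifs <;> norm_num
  have hpt : ∀ b ∈ B, w b * #(N b ∩ Ag) ≤
      (if b ∈ B' then t * P ^ t else 0) + (w b * #(N b ∩ S) + w b * M) := by
    intro b hb
    have hr : (0 : ℝ) ≤ w b * #(N b ∩ S) + w b * M := by
      have := hw0 b hb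
      positivity
    split_ifs with hbB
    · have h4 : (#(N b ∩ Ag) : ℝ) ≤ t := by
        rw [← hN b hb]
        exact_mod_cast card_le_card inter_subset_left
      have h5 : w b * #(N b ∩ Ag) ≤ P ^ t * t :=
        mul_le_mul (hwP b hb) h4 (Nat.cast_nonneg _) (by positivity)
      linarith
    · by_cases hbX : N b ⊆ X
      · have h4 : (#(N b ∩ Ag) : ℝ) ≤ #(N b ∩ S) + M := by
          exact_mod_cast h3 b (mem_sdiff.2 ⟨mem_filter.2 ⟨hb, hbX⟩, hbB⟩)
        nlinarith [mul_le_mul_of_nonneg_left h4 (hw0 b hb)]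
      · have : w b = 0 := by rw [hw]; simp only [subsetInd, if_neg hbX, mul_zero]
        simp [this]
  have hsum := sum_le_sum hpt
  rw [sum_add_distrib, sum_add_distrib, ← sum_mul, ← sum_filter, sum_const, nsmul_eq_mul,
    sum_invProb_mul_card_inter N B p X S, sum_invProb_mul_card_inter N B p X Ag,
    filter_mem_eq_inter, inter_eq_right.2 (hB'.trans (filter_subset _ _))] at hsum
  have hSle : ∑ u ∈ S, randDeg N B p u X ≤ #S * (4 * Λ) := by
    rw [← nsmul_eq_mul]
    exact sum_le_card_nsmul _ _ _ fun u hu => not_lt.1 (mem_filter.1 (hS hu)).2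
  have htot : ∑ b ∈ B, w b * t = ∑ u ∈ X, randDeg N B p u X := by
    rw [← sum_invProb_mul_card_inter]
    refine sum_congr rfl fun b hb => ?_
    by_cases hbX : N b ⊆ X
    · rw [inter_eq_left.2 hbX, hN b hb]
    · have : w b = 0 := by rw [hw]; simp only [subsetInd, if_neg hbX, mul_zero]
      rw [this, subsetInd, if_neg hbX]
      simp
  have hsplit : ∑ u ∈ Ag, randDeg N B p u X +
      ∑ u ∈ X, (if 4 * Λ < randDeg N B p u X then randDeg N B p u X else 0) =
      ∑ u ∈ X, randDeg N B p u X := by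
    rw [← sum_filter, add_comm]
    exact sum_filter_add_sum_filter_not _ _ _
  rw [← sum_mul] at htot
  have hAgX : (#Ag : ℝ) ≤ #X := by exact_mod_cast card_le_card (filter_subset _ _)
  have h1' : (63 : ℝ) * #S ≤ #B' := by exact_mod_cast h1
  have h2' : (63 : ℝ) * #B' ≤ #Ag := by exact_mod_cast h2
  have ht' : (t : ℝ) = 2 * M := by exact_mod_cast ht
  have h6 : (#B' : ℝ) * (t * P ^ t) ≤ #B' * Λ := mul_le_mul_of_nonneg_left hPt (Nat.cast_nonneg _)
  have h7 : (#S : ℝ) * (4 * Λ) ≤ 4 / 3969 * Λ * #X := by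
    nlinarith
  have h8 : (#B' : ℝ) * Λ ≤ 1 / 63 * Λ * #X := by
    nlinarith
  rw [ht'] at htot
  linarith

lemma hasDenseSub_of_codegree_le {N : β → Finset α} {A : Finset α} {B : Finset β} {M t : ℕ}
    (hM : 1 ≤ M) (ht : t = 2 * M) (hB : B.Nonempty) (hN : ∀ b ∈ B, N b ⊆ A ∧ #(N b) = t)
    {D Λ θ : ℝ} (hD : 0 < D) (hDΛ : D ≤ Λ) (hθ : 0 ≤ θ) (hDA : D * #A ≤ #B)
    (hdeg : ∀ u ∈ A, (#{b ∈ B | u ∈ N b} : ℝ) ≤ Λ)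
    (hco : ∀ u v, u ≠ v → (#{b ∈ B | u ∈ N b ∧ v ∈ N b} : ℝ) ≤ θ)
    (h1 : 16 * t * (Λ / D) ^ t * θ ≤ Λ) (h2 : t * (Λ / D) ^ t ≤ Λ) : HasDenseSub N B M := by
  by_contra hno
  have hΛ : 0 < Λ := hD.trans_le hDΛ
  set P := Λ / D with hP
  have hP1 : 1 ≤ P := (one_le_div hD).2 hDΛ
  set p : α → ℝ := fun u => max (#{b ∈ B | u ∈ N b} : ℝ) D / Λ with hpdef
  have hp : ∀ u ∈ A, 0 < p u ∧ p u ≤ 1 ∧ (p u)⁻¹ ≤ P := by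
    intro u hu
    have h3 : D ≤ max (#{b ∈ B | u ∈ N b} : ℝ) D := le_max_right _ _
    refine ⟨div_pos (hD.trans_le h3) hΛ, (div_le_one hΛ).2 (max_le (hdeg u hu) hDΛ), ?_⟩
    rw [hpdef, inv_div]
    exact div_le_div_of_nonneg_left hΛ.le hD h3
  have hinv : ∀ b ∈ B, 0 ≤ invProb p (N b) ∧ invProb p (N b) ≤ P ^ t := fun b hb =>
    ⟨prod_nonneg fun u hu => (inv_pos.2 (hp u ((hN b hb).1 hu)).1).le,
      invProb_le_pow hP1 (hN b hb).1 (fun u hu => ⟨(hp u hu).1, (hp u hu).2.2⟩) (hN b hb).2.le⟩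
  set ex : α → Finset α → ℝ := fun u X =>
    if 4 * Λ < randDeg N B p u X then randDeg N B p u X else 0 with hex
  have hsumdeg : ∑ u ∈ A, (#{b ∈ B | u ∈ N b} : ℝ) = #B * t := by
    rw [← Nat.cast_sum, ← sum_card_inter_eq, sum_const_nat fun b hb => by
      rw [inter_eq_left.2 (hN b hb).1, (hN b hb).2]]
    push_cast
    rfl
  have hBpos : (0 : ℝ) < #B := by exact_mod_cast hB.card_pos
  have hM' : (1 : ℝ) ≤ M := by exact_mod_cast hM
  have ht' : (t : ℝ) = 2 * M := by exact_mod_cast ht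
  have hEW : subsetMean A p (fun X => M * ∑ b ∈ B, invProb p (N b) * subsetInd (N b) X) =
      M * #B := by
    rw [subsetMean_const_mul, subsetMean_sum, sum_congr rfl fun b hb =>
      subsetMean_invProb_mul (fun u hu => (hp u hu).1) (hN b hb).1]
    simp
  have hEex : subsetMean A p (fun X => ∑ u ∈ A, ex u X) ≤ M * #B / 8 := by
    rw [subsetMean_sum]
    calc ∑ u ∈ A, subsetMean A p (ex u) ≤ ∑ u ∈ A, P ^ t * t * θ * (#{b ∈ B | u ∈ N b} : ℝ) / Λ := by
          refine sum_le_sum fun u hu => subsetMean_excess_le hP1 hθ hΛ hN hp hco hu ?_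
          rw [hpdef, mul_div_cancel₀ _ hΛ.ne']
          exact le_max_left _ _
      _ = (16 * t * P ^ t * θ) / Λ * (#B * t / 16) := by
          rw [← sum_div, ← mul_sum, hsumdeg]
          ring
      _ ≤ 1 * (#B * t / 16) := by
          gcongr
          exact (div_le_one hΛ).2 h1
      _ = M * #B / 8 := by
          rw [ht']
          ring
  have hEX : subsetMean A p (fun X => 67 / 3969 * Λ * #X) ≤ 67 / 3969 * ((t + 1) * #B) := by
    rw [subsetMean_const_mul, subsetMean_card, mul_assoc]
    refine mul_le_mul_of_nonneg_left ?_ (by norm_num)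
    rw [mul_sum]
    calc ∑ u ∈ A, Λ * p u ≤ ∑ u ∈ A, ((#{b ∈ B | u ∈ N b} : ℝ) + D) := by
          refine sum_le_sum fun u _ => ?_
          rw [hpdef, mul_div_cancel₀ _ hΛ.ne']
          exact max_le (by linarith) (by linarith [(Nat.cast_nonneg _ :
            (0 : ℝ) ≤ #{b ∈ B | u ∈ N b})])
      _ ≤ (t + 1) * #B := by
          rw [sum_add_distrib, hsumdeg, sum_const, nsmul_eq_mul]
          linarith
  obtain ⟨X, hXA, hX⟩ := exists_pos_of_subsetMean_pos (A := A) (p := p)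
    (f := fun X => (M * ∑ b ∈ B, invProb p (N b) * subsetInd (N b) X - ∑ u ∈ A, ex u X) -
      67 / 3969 * Λ * #X) (fun u hu => ⟨(hp u hu).1.le, (hp u hu).2.1⟩) (by
        rw [subsetMean_sub, subsetMean_sub, hEW]
        nlinarith)
  have hle := weight_sub_excess_le hM ht hno (by linarith) hΛ (fun b hb => (hN b hb).2) hinv h2 X
  have hexA : ∑ u ∈ A, ex u X = ∑ u ∈ X, ex u X := by
    refine (sum_subset hXA fun u _ hu => ?_).symm
    simp only [hex, randDeg_eq_zero N B p hu, ite_self]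
  rw [hexA] at hX
  simp only [hex] at hX
  linarith

lemma exists_independent_subset {S : Finset α} {R : α → α → Prop} (hR : ∀ u v, R u v → R v u)
    (hirr : ∀ u, ¬ R u u) {k : ℕ} (h : ∀ u ∈ S, #{v ∈ S | R u v} + 1 ≤ k) :
    ∃ I ⊆ S, (∀ u ∈ I, ∀ v ∈ I, ¬ R u v) ∧ #S ≤ #I * k := by
  obtain ⟨Q, hQ⟩ : ∃ Q : Finset α → Prop, ∀ I, Q I ↔ ∀ u ∈ I, ∀ v ∈ I, ¬ R u v :=
    ⟨_, fun _ => Iff.rfl⟩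
  obtain ⟨I, hI, hmax⟩ := exists_max_image {I ∈ S.powerset | Q I} card ⟨∅, by simp [hQ]⟩
  rw [mem_filter, mem_powerset, hQ] at hI
  refine ⟨I, hI.1, hI.2, ?_⟩
  have hcov : S ⊆ I.biUnion fun u => insert u {v ∈ S | R u v} := by
    intro v hv
    rw [mem_biUnion]
    by_cases hvI : v ∈ I
    · exact ⟨v, hvI, mem_insert_self _ _⟩
    by_contra! hno
    have hno' : ∀ u ∈ I, ¬ R u v := fun u hu hR' =>
      hno u hu (mem_insert_of_mem (mem_filter.2 ⟨hv, hR'⟩))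
    have := hmax (insert v I) (mem_filter.2 ⟨mem_powerset.2 (insert_subset hv hI.1), (hQ _).2 ?_⟩)
    · rw [card_insert_of_notMem hvI] at this
      omega
    · intro a ha b hb hab
      rw [mem_insert] at ha hb
      obtain rfl | ha := ha
      · obtain rfl | hb := hb
        · exact hirr _ hab
        · exact hno' b hb (hR _ _ hab)
      · obtain rfl | hb := hb
        · exact hno' a ha hab
        · exact hI.2 a ha b hb hab
  exact (card_le_card hcov).trans (card_biUnion_le_card_mul _ _ _ fun u hu =>
    (card_insert_le _ _).trans (h u (hI.1 hu)))

lemma card_conflicting_le {N : β → Finset α} {A : Finset α} {B : Finset β} {k c : ℕ}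
    (hk : 1 ≤ k) (hN : ∀ b ∈ B, N b ⊆ A) {conf : α → Finset α}
    (hconf : ∀ u ∈ A, conf u ⊆ A ∧ u ∉ conf u ∧ #(conf u) ≤ c)
    (hK : ∀ K ⊆ A, #K = k → #{b ∈ B | K ⊆ N b} < k) :
    #{b ∈ B | ∃ u ∈ N b, k ≤ #(N b ∩ conf u) + 1} ≤ #A * (c ^ (k - 1) * k) := by
  have hcov : {b ∈ B | ∃ u ∈ N b, k ≤ #(N b ∩ conf u) + 1} ⊆
      A.biUnion fun u => ((conf u).powersetCard (k - 1)).biUnion fun Y =>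
        {b ∈ B | insert u Y ⊆ N b} := by
    intro b hb
    obtain ⟨hb, u, hu, hle⟩ := mem_filter.1 hb
    obtain ⟨Y, hY, hYc⟩ := exists_subset_card_eq (show k - 1 ≤ #(N b ∩ conf u) by omega)
    simp only [mem_biUnion, mem_powersetCard, mem_filter]
    exact ⟨u, hN b hb hu, Y, ⟨hY.trans inter_subset_right, hYc⟩, hb,
      insert_subset hu (hY.trans inter_subset_left)⟩
  refine (card_le_card hcov).trans (card_biUnion_le_card_mul _ _ _ fun u hu => ?_)
  obtain ⟨h1, h2, h3⟩ := hconf u hu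
  refine (card_biUnion_le_card_mul _ _ k fun Y hY => ?_).trans ?_
  · rw [mem_powersetCard] at hY
    refine (hK _ (insert_subset hu (hY.1.trans h1)) ?_).le
    rw [card_insert_of_notMem fun h => h2 (hY.1 h), hY.2]
    omega
  · rw [card_powersetCard]
    exact Nat.mul_le_mul_right _ ((Nat.choose_le_pow _ _).trans (Nat.pow_le_pow_left h3 _))

lemma card_high_codegree_le {N : β → Finset α} {A : Finset α} {B : Finset β} {s n m g : ℕ}
    (hN : ∀ b ∈ B, N b ⊆ A ∧ #(N b) = s) {u : α}
    (hdeg : #{b ∈ B | u ∈ N b} ≤ 2 ^ (n + m)) :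
    #{v ∈ A | v ≠ u ∧ 2 ^ n < 2 ^ g * #{b ∈ B | u ∈ N b ∧ v ∈ N b}} ≤ s * 2 ^ (g + m) := by
  set C := {v ∈ A | v ≠ u ∧ 2 ^ n < 2 ^ g * #{b ∈ B | u ∈ N b ∧ v ∈ N b}}
  have h1 : #C * 2 ^ n ≤ ∑ v ∈ C, 2 ^ g * #{b ∈ B | u ∈ N b ∧ v ∈ N b} := by
    rw [← smul_eq_mul]
    exact card_nsmul_le_sum _ _ _ fun v hv => (mem_filter.1 hv).2.2.le
  have h2 : ∑ v ∈ C, #{b ∈ B | u ∈ N b ∧ v ∈ N b} ≤ s * 2 ^ (n + m) := by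
    calc ∑ v ∈ C, #{b ∈ B | u ∈ N b ∧ v ∈ N b}
        ≤ ∑ v ∈ A, #{b ∈ B | u ∈ N b ∧ v ∈ N b} := sum_le_sum_of_subset (filter_subset _ _)
      _ = ∑ b ∈ B with u ∈ N b, #(N b ∩ A) := by
          rw [sum_card_inter_eq]
          simp only [filter_filter]
      _ = #{b ∈ B | u ∈ N b} * s := sum_const_nat fun b hb => by
          have := hN b (mem_filter.1 hb).1
          rw [inter_eq_left.2 this.1, this.2]
      _ ≤ s * 2 ^ (n + m) := by
          rw [mul_comm]
          exact Nat.mul_le_mul_left _ hdeg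
  rw [← mul_sum] at h1
  refine Nat.le_of_mul_le_mul_right (h1.trans ((Nat.mul_le_mul_left _ h2).trans_eq ?_))
    (show 0 < 2 ^ n by positivity)
  ring

lemma hasDenseSub_of_deg_le {N : β → Finset α} {A : Finset α} {B : Finset β} {M k n m g : ℕ}
    (hM : 1 ≤ M) (hk : 1 ≤ k) (hB : B.Nonempty) (hN : ∀ b ∈ B, N b ⊆ A ∧ #(N b) = 2 * M * k)
    (hAB : 2 ^ n * #A ≤ #B) (hdeg : ∀ u ∈ A, #{b ∈ B | u ∈ N b} ≤ 2 ^ (n + m))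
    (hK : ∀ K ⊆ A, #K = k → #{b ∈ B | K ⊆ N b} < k)
    (h1 : 2 * k * (2 * M * k * 2 ^ (g + m)) ^ k ≤ 2 ^ n)
    (h2 : 32 * M * (2 ^ (m + 1)) ^ (2 * M) ≤ 2 ^ g) (hg : g ≤ n) : HasDenseSub N B M := by
  obtain ⟨R, hR⟩ : ∃ R : α → α → Prop, ∀ u v, R u v ↔
      v ≠ u ∧ 2 ^ n < 2 ^ g * #{b ∈ B | u ∈ N b ∧ v ∈ N b} := ⟨_, fun _ _ => Iff.rfl⟩
  set bad := {b ∈ B | ∃ u ∈ N b, k ≤ #(N b ∩ {v ∈ A | R u v}) + 1}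
  have hbadB : bad ⊆ B := filter_subset _ _
  have hbadc : 2 * #bad ≤ #B := by
    have h3 : #bad ≤ #A * ((2 * M * k * 2 ^ (g + m)) ^ (k - 1) * k) :=
      card_conflicting_le hk (fun b hb => (hN b hb).1) (fun u hu =>
        ⟨filter_subset _ _, fun h => ((hR u u).1 (mem_filter.1 h).2).1 rfl, by
          simpa only [hR] using card_high_codegree_le hN (hdeg u hu)⟩) hK
    have h4 : (2 * M * k * 2 ^ (g + m)) ^ (k - 1) ≤ (2 * M * k * 2 ^ (g + m)) ^ k :=
      Nat.pow_le_pow_right (by positivity) (Nat.sub_le _ _)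
    calc 2 * #bad ≤ 2 * (#A * ((2 * M * k * 2 ^ (g + m)) ^ k * k)) :=
          Nat.mul_le_mul_left _ (h3.trans (Nat.mul_le_mul_left _ (Nat.mul_le_mul_right _ h4)))
      _ = 2 * k * (2 * M * k * 2 ^ (g + m)) ^ k * #A := by ring
      _ ≤ 2 ^ n * #A := Nat.mul_le_mul_right _ h1
      _ ≤ #B := hAB
  have hsub : ∀ b ∈ B \ bad, ∃ I ⊆ N b, (∀ u ∈ I, ∀ v ∈ I, ¬ R u v) ∧ #I = 2 * M := by
    intro b hb
    obtain ⟨hb, hnb⟩ := mem_sdiff.1 hb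
    obtain ⟨I, hI, hind, hcard⟩ := exists_independent_subset (S := N b) (R := R) (k := k)
      (fun u v h => (hR v u).2 ⟨((hR u v).1 h).1.symm, by
        simpa only [and_comm] using ((hR u v).1 h).2⟩) (fun u h => ((hR u u).1 h).1 rfl) (by
        intro u hu
        by_contra! hlt
        refine hnb (mem_filter.2 ⟨hb, u, hu, ?_⟩)
        rw [inter_filter, inter_eq_left.2 (hN b hb).1]
        exact hlt.le)
    rw [(hN b hb).2] at hcard
    obtain ⟨I', hI', hc⟩ := exists_subset_card_eq (Nat.le_of_mul_le_mul_right hcard hk)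
    exact ⟨I', hI'.trans hI, fun u hu v hv => hind u (hI' hu) v (hI' hv), hc⟩
  choose! N' hN' hind hcard using hsub
  have hcd := card_sdiff_add_card_eq_card hbadB
  have hpos := hB.card_pos
  have hne : (B \ bad).Nonempty := card_pos.1 (by omega)
  have hBB : (#B : ℝ) ≤ 2 * #(B \ bad) := by
    have : #B ≤ 2 * #(B \ bad) := by omega
    exact_mod_cast this
  have hAB' : (2 : ℝ) ^ n * #A ≤ #B := by exact_mod_cast hAB
  have hP : (2 : ℝ) ^ (n + m) / (2 ^ n / 2) = 2 ^ (m + 1) := by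
    rw [pow_add, pow_succ]
    field_simp
  have h2' : (32 : ℝ) * M * (2 ^ (m + 1)) ^ (2 * M) ≤ 2 ^ g := by exact_mod_cast h2
  have hgn : (2 : ℝ) ^ g ≤ 2 ^ n := pow_le_pow_right₀ (by norm_num) hg
  have hnm : (2 : ℝ) ^ n ≤ 2 ^ (n + m) := pow_le_pow_right₀ (by norm_num) (by omega)
  have h2n : (0 : ℝ) < 2 ^ n := by positivity
  have h2g : (0 : ℝ) < 2 ^ g := by positivity
  refine HasDenseSub.mono (sdiff_subset : B \ bad ⊆ B) hN' (hasDenseSub_of_codegree_le (A := A) hM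
    rfl hne (fun b hb => ⟨(hN' b hb).trans (hN b (mem_sdiff.1 hb).1).1, hcard b hb⟩)
    (D := 2 ^ n / 2) (Λ := 2 ^ (n + m)) (θ := 2 ^ n / 2 ^ g) (by positivity) (by linarith)
    (by positivity) (by linarith) ?_ ?_ ?_ ?_)
  · intro u hu
    refine le_trans ?_ (by exact_mod_cast hdeg u hu : (#{b ∈ B | u ∈ N b} : ℝ) ≤ 2 ^ (n + m))
    norm_cast
    refine card_le_card fun b hb => ?_
    rw [mem_filter] at hb ⊢
    exact ⟨(mem_sdiff.1 hb.1).1, hN' b hb.1 hb.2⟩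
  · intro u v huv
    rcases {b ∈ B \ bad | u ∈ N' b ∧ v ∈ N' b}.eq_empty_or_nonempty with h | ⟨b, hb⟩
    · rw [h]
      simp only [card_empty, Nat.cast_zero]
      positivity
    · rw [mem_filter] at hb
      have h3 := hind b hb.1 u hb.2.1 v hb.2.2
      rw [hR, not_and, not_lt] at h3
      have h4 : (2 : ℝ) ^ g * #{b ∈ B | u ∈ N b ∧ v ∈ N b} ≤ 2 ^ n := by
        exact_mod_cast h3 huv.symm
      have h5 : (#{b ∈ B \ bad | u ∈ N' b ∧ v ∈ N' b} : ℝ) ≤ #{b ∈ B | u ∈ N b ∧ v ∈ N b} := by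
        norm_cast
        refine card_le_card fun b hb => ?_
        rw [mem_filter] at hb ⊢
        exact ⟨(mem_sdiff.1 hb.1).1, hN' b hb.1 hb.2.1, hN' b hb.1 hb.2.2⟩
      rw [le_div_iff₀ h2g]
      nlinarith
  · rw [hP]
    push_cast
    calc (16 : ℝ) * (2 * M) * (2 ^ (m + 1)) ^ (2 * M) * (2 ^ n / 2 ^ g)
        = 32 * M * (2 ^ (m + 1)) ^ (2 * M) * (2 ^ n / 2 ^ g) := by ring
      _ ≤ 2 ^ g * (2 ^ n / 2 ^ g) := by gcongr
      _ = 2 ^ n := by field_simp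
      _ ≤ _ := hnm
  · rw [hP]
    push_cast
    have : (0 : ℝ) ≤ M * (2 ^ (m + 1)) ^ (2 * M) := by positivity
    linarith

lemma two_mul_le_two_pow {k : ℕ} (hk : 1 ≤ k) : 2 * k ≤ 2 ^ k := by
  have h := (k - 1).lt_two_pow_self
  obtain ⟨j, rfl⟩ := Nat.exists_eq_add_of_le' hk
  rw [Nat.add_sub_cancel] at h
  rw [pow_succ]
  omega

lemma exists_high_step {N : β → Finset α} {A : Finset α} {B : Finset β} {M k n q d d₀ s : ℕ}
    (hM : 1 ≤ M) (hk : 1 ≤ k) (hs : s = 2 * M * k) (hno : ¬ HasDenseSub N B M)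
    (hB : B.Nonempty) (hAB : 2 ^ (n + 1) * #A ≤ #B) (hd : ∀ b ∈ B, d ≤ #(N b ∩ A))
    (hd₀ : ∀ b ∈ B, #(N b) ≤ d₀) (hsd : s ≤ d₀) (hq : 4 * d₀ ≤ 2 ^ q) (hn : 8 * s * q ≤ n)
    (hK : ∀ K ⊆ A, #K = k → #{b ∈ B | K ⊆ N b} < k) :
    ∃ A' ⊆ A, ∃ B' ⊆ B, B'.Nonempty ∧ 2 ^ (n + q + 1) * #A' ≤ #B' ∧
      ∀ b ∈ B', d ≤ #(N b ∩ A') + s := by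
  have hMk : 1 ≤ M * k := Nat.mul_pos hM hk
  have hq2 : 2 ≤ q := by
    by_contra! hlt
    have : 2 ^ q ≤ 2 ^ 1 := Nat.pow_le_pow_right (by norm_num) (by omega)
    rw [mul_assoc] at hs
    omega
  set H := {u ∈ A | 2 ^ (n + 2 * q) < #{b ∈ B | u ∈ N b}}
  set B₁ := {b ∈ B | d ≤ #(N b ∩ H) + s}
  have hB₁ : B₁ ⊆ B := filter_subset _ _
  have hHA : H ⊆ A := filter_subset _ _
  have hpos := hB.card_pos
  by_cases hbig : #B ≤ 2 * #B₁
  · refine ⟨H, hHA, B₁, hB₁, card_pos.1 (by omega), ?_, fun b hb => (mem_filter.1 hb).2⟩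
    have h1 : #H * 2 ^ (n + 2 * q) ≤ #B * d₀ := by
      calc #H * 2 ^ (n + 2 * q) ≤ ∑ u ∈ H, #{b ∈ B | u ∈ N b} := by
            rw [← smul_eq_mul]
            exact card_nsmul_le_sum _ _ _ fun v hv => (mem_filter.1 hv).2.le
        _ = ∑ b ∈ B, #(N b ∩ H) := (sum_card_inter_eq _ _ _).symm
        _ ≤ #B * d₀ := by
            rw [← smul_eq_mul]
            exact sum_le_card_nsmul _ _ _ fun b hb =>
              (card_le_card inter_subset_left).trans (hd₀ b hb)
    refine Nat.le_of_mul_le_mul_right ?_ (show 0 < 2 ^ q by positivity)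
    calc 2 ^ (n + q + 1) * #H * 2 ^ q = 2 * (#H * 2 ^ (n + 2 * q)) := by ring
      _ ≤ 2 * (#B * d₀) := by omega
      _ ≤ 2 * (2 * #B₁ * d₀) := by gcongr
      _ = #B₁ * (4 * d₀) := by ring
      _ ≤ #B₁ * 2 ^ q := Nat.mul_le_mul_left _ hq
  · exfalso
    have hcd := card_sdiff_add_card_eq_card hB₁
    have hsub : ∀ b ∈ B \ B₁, ∃ Y ⊆ N b ∩ (A \ H), #Y = s := by
      intro b hb
      obtain ⟨hb, hnb⟩ := mem_sdiff.1 hb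
      have h1 : #(N b ∩ H) + s < d := by
        by_contra! h
        exact hnb (mem_filter.2 ⟨hb, h⟩)
      have h2 : #(N b ∩ A) ≤ #(N b ∩ H) + #(N b ∩ (A \ H)) := by
        refine le_trans (card_le_card ?_) (card_union_le _ _)
        rw [← inter_union_distrib_left, union_sdiff_of_subset hHA]
      have := hd b hb
      exact exists_subset_card_eq (by omega)
    choose! N' hN' hc using hsub
    refine hno (HasDenseSub.mono (sdiff_subset : B \ B₁ ⊆ B)
      (fun b hb => (hN' b hb).trans inter_subset_left)
      (hasDenseSub_of_deg_le (A := A \ H) (k := k) (n := n) (m := 2 * q)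
        (g := 2 * M * (2 * q + 5)) hM hk (card_pos.1 (by omega)) (fun b hb =>
        ⟨(hN' b hb).trans inter_subset_right, (hc b hb).trans hs⟩) ?_ ?_ ?_ ?_ ?_ ?_))
    · have h1 : 2 ^ n * #(A \ H) ≤ 2 ^ n * #A := Nat.mul_le_mul_left _ (card_le_card sdiff_subset)
      rw [pow_succ, mul_right_comm] at hAB
      omega
    · intro u hu
      obtain ⟨hu, hnu⟩ := mem_sdiff.1 hu
      have h1 : #{b ∈ B | u ∈ N b} ≤ 2 ^ (n + 2 * q) := by
        by_contra! h
        exact hnu (mem_filter.2 ⟨hu, h⟩)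
      refine le_trans (card_le_card fun b hb => ?_) h1
      rw [mem_filter] at hb ⊢
      exact ⟨(mem_sdiff.1 hb.1).1, inter_subset_left (hN' b hb.1 hb.2)⟩
    · intro K hKA hKc
      refine lt_of_le_of_lt (card_le_card fun b hb => ?_) (hK K (hKA.trans sdiff_subset) hKc)
      rw [mem_filter] at hb ⊢
      exact ⟨(mem_sdiff.1 hb.1).1, (hb.2.trans (hN' b hb.1)).trans inter_subset_left⟩
    · rw [← hs]
      calc 2 * k * (s * 2 ^ (2 * M * (2 * q + 5) + 2 * q)) ^ k
          ≤ 2 ^ k * (2 ^ q * 2 ^ (2 * M * (2 * q + 5) + 2 * q)) ^ k := by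
            gcongr
            · exact two_mul_le_two_pow hk
            · omega
        _ = 2 ^ (k * (1 + 3 * q + 2 * M * (2 * q + 5))) := by
            rw [← pow_add, ← pow_mul, ← pow_add]
            ring_nf
        _ ≤ 2 ^ n := by
            refine Nat.pow_le_pow_right (by norm_num) (le_trans ?_ hn)
            have h3 : 1 + 3 * q + 2 * M * (2 * q + 5) ≤ 16 * M * q := by nlinarith
            calc k * (1 + 3 * q + 2 * M * (2 * q + 5)) ≤ k * (16 * M * q) :=
                  Nat.mul_le_mul_left _ h3
              _ = 8 * s * q := by rw [hs]; ring
    · have h3 : 32 * M ≤ 2 ^ (8 * M) := by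
        calc 32 * M ≤ 2 ^ 5 * 2 ^ M := by
              have := M.lt_two_pow_self
              omega
          _ = 2 ^ (5 + M) := (pow_add _ _ _).symm
          _ ≤ 2 ^ (8 * M) := Nat.pow_le_pow_right (by norm_num) (by omega)
      calc 32 * M * (2 ^ (2 * q + 1)) ^ (2 * M)
          ≤ 2 ^ (8 * M) * (2 ^ (2 * q + 1)) ^ (2 * M) := Nat.mul_le_mul_right _ h3
        _ = 2 ^ (2 * M * (2 * q + 5)) := by
            rw [← pow_mul, ← pow_add]
            ring_nf
    · refine le_trans ?_ hn
      have h3 : 2 * (2 * q + 5) ≤ 16 * q := by omega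
      calc 2 * M * (2 * q + 5) = M * (2 * (2 * q + 5)) := by ring
        _ ≤ M * (16 * q) := Nat.mul_le_mul_left _ h3
        _ ≤ M * (16 * q) * k := Nat.le_mul_of_pos_right _ hk
        _ = 8 * s * q := by rw [hs]; ring

lemma exists_high_steps {N : β → Finset α} {A : Finset α} {B : Finset β} {M k n q d d₀ s : ℕ}
    (hM : 1 ≤ M) (hk : 1 ≤ k) (hs : s = 2 * M * k) (hno : ¬ HasDenseSub N B M)
    (hB : B.Nonempty) (hAB : 2 ^ (n + 1) * #A ≤ #B) (hd : ∀ b ∈ B, d ≤ #(N b ∩ A))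
    (hd₀ : ∀ b ∈ B, #(N b) ≤ d₀) (hsd : s ≤ d₀) (hq : 4 * d₀ ≤ 2 ^ q) (hn : 8 * s * q ≤ n)
    (hK : ∀ K ⊆ A, #K = k → #{b ∈ B | K ⊆ N b} < k) (i : ℕ) :
    ∃ A' ⊆ A, ∃ B' ⊆ B, B'.Nonempty ∧ 2 ^ (n + i * q + 1) * #A' ≤ #B' ∧
      ∀ b ∈ B', d ≤ #(N b ∩ A') + i * s := by
  induction i with
  | zero => exact ⟨A, subset_rfl, B, subset_rfl, hB, by simpa, by simpa⟩
  | succ i ih =>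
    obtain ⟨A₁, hA₁, B₁, hB₁, hne, hc, hd₁⟩ := ih
    obtain ⟨A₂, hA₂, B₂, hB₂, hne', hc', hd₂⟩ := exists_high_step (d := d - i * s) hM hk hs
      (fun h => hno (h.mono hB₁ fun _ _ => subset_rfl)) hne hc
      (fun b hb => Nat.sub_le_of_le_add (hd₁ b hb)) (fun b hb => hd₀ b (hB₁ hb)) hsd hq
      (hn.trans (Nat.le_add_right _ _))
      (fun K hKA hKc => lt_of_le_of_lt (card_le_card (filter_subset_filter _ hB₁))
        (hK K (hKA.trans hA₁) hKc))
    refine ⟨A₂, hA₂.trans hA₁, B₂, hB₂.trans hB₁, hne', ?_, fun b hb => ?_⟩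
    · rwa [add_one_mul, ← add_assoc]
    · have := hd₂ b hb
      rw [add_one_mul]
      omega

lemma exists_high_phases {N : β → Finset α} {A : Finset α} {B : Finset β} {M k L d d₀ s : ℕ}
    (hM : 1 ≤ M) (hk : 1 ≤ k) (hs : s = 2 * M * k) (hno : ¬ HasDenseSub N B M)
    (hB : B.Nonempty) (hAB : 2 ^ (8 * s * L + 1) * #A ≤ #B) (hd : ∀ b ∈ B, d ≤ #(N b ∩ A))
    (hd₀ : ∀ b ∈ B, #(N b) ≤ d₀) (hsd : s ≤ d₀) (hL : 4 * d₀ ≤ 2 ^ L)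
    (hK : ∀ K ⊆ A, #K = k → #{b ∈ B | K ⊆ N b} < k) (J : ℕ) :
    ∃ A' ⊆ A, ∃ B' ⊆ B, B'.Nonempty ∧ 2 ^ (8 * s * (L * 2 ^ J) + 1) * #A' ≤ #B' ∧
      ∀ b ∈ B', d ≤ #(N b ∩ A') + J * (8 * s * s) := by
  induction J with
  | zero => exact ⟨A, subset_rfl, B, subset_rfl, hB, by simpa, by simpa⟩
  | succ J ih =>
    obtain ⟨A₁, hA₁, B₁, hB₁, hne, hc, hd₁⟩ := ih
    have hLJ : L ≤ L * 2 ^ J := Nat.le_mul_of_pos_right _ (by positivity)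
    obtain ⟨A₂, hA₂, B₂, hB₂, hne', hc', hd₂⟩ := exists_high_steps (d := d - J * (8 * s * s))
      hM hk hs (fun h => hno (h.mono hB₁ fun _ _ => subset_rfl)) hne hc
      (fun b hb => Nat.sub_le_of_le_add (hd₁ b hb)) (fun b hb => hd₀ b (hB₁ hb)) hsd
      (hL.trans (Nat.pow_le_pow_right (by norm_num) hLJ)) le_rfl
      (fun K hKA hKc => lt_of_le_of_lt (card_le_card (filter_subset_filter _ hB₁))
        (hK K (hKA.trans hA₁) hKc)) (8 * s)
    refine ⟨A₂, hA₂.trans hA₁, B₂, hB₂.trans hB₁, hne', ?_, fun b hb => ?_⟩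
    · have h1 : 8 * s * (L * 2 ^ (J + 1)) = 8 * s * (L * 2 ^ J) + 8 * s * (L * 2 ^ J) := by ring
      rwa [h1]
    · have := hd₂ b hb
      rw [add_one_mul]
      omega

/-- A family of `d₀`-sets with few common supersets of any `k` points has a dense subfamily of
bounded degree, as soon as `d₀` is large in terms of `M`, `k` and the iterated logarithm of the
largest degree. -/
lemma hasDenseSub_of_large {N : β → Finset α} {A : Finset α} {B : Finset β}
    {M k L J Δ d₀ s : ℕ} (hM : 1 ≤ M) (hk : 1 ≤ k) (hs : s = 2 * M * k) (hB : B.Nonempty)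
    (hN : ∀ b ∈ B, N b ⊆ A ∧ #(N b) = d₀) (hAB : #A ≤ #B)
    (hdeg : ∀ u ∈ A, #{b ∈ B | u ∈ N b} ≤ Δ) (hΔ : Δ ≤ 2 ^ 2 ^ J) (hL : 4 * d₀ ≤ 2 ^ L)
    (hK : ∀ K ⊆ A, #K = k → #{b ∈ B | K ⊆ N b} < k)
    (hd : (8 * s * L + 1) * M + J * (8 * s * s) + 1 ≤ d₀) (hsd : s ≤ d₀) (hL1 : 1 ≤ L) :
    HasDenseSub N B M := by
  by_contra hno
  obtain ⟨A₁, hA₁, B₁, hB₁, hne, hc, hd₁⟩ := exists_low (A := A) (d := d₀) hM hno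
    (fun b hb => by rw [inter_eq_left.2 (hN b hb).1, (hN b hb).2]) hAB hB (8 * s * L + 1)
  obtain ⟨A₂, hA₂, B₂, hB₂, hne', hc', hd₂⟩ := exists_high_phases
    (d := d₀ - (8 * s * L + 1) * M) hM hk hs
    (fun h => hno (h.mono hB₁ fun _ _ => subset_rfl)) hne hc
    (fun b hb => Nat.sub_le_of_le_add (hd₁ b hb)) (fun b hb => (hN b (hB₁ hb)).2.le) hsd hL
    (fun K hKA hKc => lt_of_le_of_lt (card_le_card (filter_subset_filter _ hB₁))
        (hK K (hKA.trans hA₁) hKc)) J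
  have h1 : #B₂ ≤ #A₂ * Δ := by
    calc #B₂ = ∑ b ∈ B₂, 1 := by simp
      _ ≤ ∑ b ∈ B₂, #(N b ∩ A₂) := sum_le_sum fun b hb => by
          have := hd₂ b hb
          omega
      _ = ∑ u ∈ A₂, #{b ∈ B₂ | u ∈ N b} := sum_card_inter_eq _ _ _
      _ ≤ #A₂ * Δ := by
          rw [← smul_eq_mul]
          exact sum_le_card_nsmul _ _ _ fun u hu =>
            (card_le_card (filter_subset_filter _ (hB₂.trans hB₁))).trans
              (hdeg u (hA₁ (hA₂ hu)))
  have hpos := hne'.card_pos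
  have hA₂pos : 0 < #A₂ := by
    by_contra! h
    rw [Nat.le_zero.1 h] at h1
    omega
  have h2 : 2 ^ 2 ^ J < 2 ^ (8 * s * (L * 2 ^ J) + 1) := by
    refine Nat.pow_lt_pow_right (by norm_num) ?_
    have hs1 : 1 ≤ s * L := Nat.mul_pos (by rw [hs]; positivity) hL1
    have : 1 * 2 ^ J ≤ s * L * 2 ^ J := Nat.mul_le_mul_right _ hs1
    nlinarith
  have h3 : #A₂ * Δ < 2 ^ (8 * s * (L * 2 ^ J) + 1) * #A₂ := by
    rw [mul_comm]
    exact Nat.mul_lt_mul_of_pos_right (hΔ.trans_lt h2) hA₂pos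
  omega
end

section
open scoped Classical
variable {ι V : Type*}

/-- Among the vertex sets spanning at least `c` edges per vertex, a smallest one has minimum
degree at least `c`. -/
lemma exists_min_degree {E : Finset ι} {inc : ι → Finset V} (hinc : ∀ e ∈ E, (inc e).Nonempty)
    {c : ℝ} {U₀ : Finset V} (hU₀ : U₀.Nonempty) (h : c * #U₀ ≤ #{e ∈ E | inc e ⊆ U₀}) :
    ∃ U : Finset V, U.Nonempty ∧ c * #U ≤ #{e ∈ E | inc e ⊆ U} ∧
      ∀ v ∈ U, c ≤ #{e ∈ E | inc e ⊆ U ∧ v ∈ inc e} := by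
  induction hn : #U₀ using Nat.strong_induction_on generalizing U₀ with
  | _ n ih =>
    subst hn
    by_cases hmin : ∀ v ∈ U₀, c ≤ #{e ∈ E | inc e ⊆ U₀ ∧ v ∈ inc e}
    · exact ⟨U₀, hU₀, h, hmin⟩
    push Not at hmin
    obtain ⟨v, hv, hlt⟩ := hmin
    have hsplit : #{e ∈ E | inc e ⊆ U₀} =
        #{e ∈ E | inc e ⊆ U₀ ∧ v ∈ inc e} + #{e ∈ E | inc e ⊆ U₀.erase v} := by
      rw [← card_filter_add_card_filter_not (s := {e ∈ E | inc e ⊆ U₀}) (fun e => v ∈ inc e),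
        filter_filter, filter_filter]
      simp only [subset_erase]
    have hcard := card_erase_add_one hv
    have h1 : c * #(U₀.erase v) ≤ #{e ∈ E | inc e ⊆ U₀.erase v} := by
      rw [hsplit, ← hcard] at h
      push_cast at h
      linarith
    rcases (U₀.erase v).eq_empty_or_nonempty with h0 | hne
    · exfalso
      have h2 : #{e ∈ E | inc e ⊆ U₀.erase v} = 0 := by
        rw [card_eq_zero, filter_eq_empty_iff, h0]
        exact fun e he hs => (hinc e he).ne_empty (subset_empty.1 hs)
      rw [hsplit, h2, ← hcard, h0] at h
      push_cast [card_empty] at h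
      linarith
    · exact ih _ (by omega) hne h1 rfl

lemma hasAlmostRegularSubgraph_of_hasDenseSub [Finite V] {G : SimpleGraph V} {A B : Finset V}
    (hAB : Disjoint A B) {N : V → Finset V} (hN : ∀ b ∈ B, ∀ a ∈ N b, a ∈ A ∧ G.Adj b a) {M : ℕ}
    (h : HasDenseSub N B M) : HasAlmostRegularSubgraph G 64 (M / 32) := by
  obtain ⟨F, hne, hF, hM1, hM2, hcard⟩ := h
  have hFA : ∀ p ∈ F, p.1 ∈ A ∧ p.2 ∈ B ∧ G.Adj p.2 p.1 := fun p hp =>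
    ⟨(hN _ (hF p hp).1 _ (hF p hp).2).1, (hF p hp).1, (hN _ (hF p hp).1 _ (hF p hp).2).2⟩
  have hAB' : ∀ v, v ∈ A → v ∉ B := fun v hv => disjoint_left.1 hAB hv
  obtain ⟨U, hU, hUc, hUd⟩ := exists_min_degree (E := F) (inc := fun p => {p.1, p.2})
    (c := M / 64) (U₀ := F.image Prod.fst ∪ F.image Prod.snd) (fun _ _ => insert_nonempty _ _)
    ((hne.image _).mono subset_union_left) (by
      rw [filter_true_of_mem fun p hp => insert_subset
        (mem_union_left _ (mem_image_of_mem _ hp))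
        (singleton_subset_iff.2 (mem_union_right _ (mem_image_of_mem _ hp)))]
      have h1 : M * #(F.image Prod.fst ∪ F.image Prod.snd) ≤ 64 * #F :=
        (Nat.mul_le_mul_left _ (card_union_le _ _)).trans hcard
      have h2 : (M : ℝ) * #(F.image Prod.fst ∪ F.image Prod.snd) ≤ 64 * #F := by exact_mod_cast h1
      linarith)
  simp only [insert_subset_iff, singleton_subset_iff, mem_insert, mem_singleton] at hUc hUd
  let H : G.Subgraph :=
    { verts := U
      Adj := fun x y => ((x, y) ∈ F ∨ (y, x) ∈ F) ∧ x ∈ U ∧ y ∈ U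
      adj_sub := by
        rintro x y ⟨h | h, -⟩
        · exact (hFA _ h).2.2.symm
        · exact (hFA _ h).2.2
      edge_vert := fun h => h.2.1
      symm := ⟨fun x y h => ⟨h.1.symm, h.2.2, h.2.1⟩⟩ }
  have hdeg : ∀ v ∈ U, subDeg H v =
      #{p ∈ F | (p.1 ∈ U ∧ p.2 ∈ U) ∧ (v = p.1 ∨ v = p.2)} := by
    intro v hv
    have h1 : H.neighborSet v = ({p ∈ F | (p.1 ∈ U ∧ p.2 ∈ U) ∧ (v = p.1 ∨ v = p.2)}.image
        fun p => if p.1 = v then p.2 else p.1 : Finset V) := by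
      ext w
      simp only [SimpleGraph.Subgraph.mem_neighborSet, H, coe_image, coe_filter, Set.mem_image,
        Set.mem_ofPred_eq, Prod.exists]
      constructor
      · rintro ⟨h | h, -, hw⟩
        · exact ⟨v, w, ⟨h, ⟨hv, hw⟩, Or.inl rfl⟩, if_pos rfl⟩
        · exact ⟨w, v, ⟨h, ⟨hw, hv⟩, Or.inr rfl⟩,
            if_neg fun h' => G.ne_of_adj (hFA _ h).2.2 h'.symm⟩
      · rintro ⟨a, b, ⟨h, ⟨ha, hb⟩, rfl | rfl⟩, hif⟩
        · rw [if_pos rfl] at hif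
          exact hif ▸ ⟨Or.inl h, ha, hb⟩
        · rw [if_neg fun h' => G.ne_of_adj (hFA _ h).2.2 h'.symm] at hif
          exact hif ▸ ⟨Or.inr h, hb, ha⟩
    rw [subDeg, h1, Set.ncard_coe_finset, card_image_of_injOn]
    rintro ⟨a, b⟩ hp ⟨a', b'⟩ hp' heq
    simp only [coe_filter, Set.mem_ofPred_eq] at hp hp' heq
    obtain ⟨hpF, -, hv1⟩ := hp
    obtain ⟨hpF', -, hv2⟩ := hp'
    have f1 := hFA _ hpF
    have f2 := hFA _ hpF'
    simp only at f1 f2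
    by_cases hvA : v ∈ A
    · have hv1' : v = a := hv1.resolve_right fun h => hAB' v hvA (h ▸ f1.2.1)
      have hv2' : v = a' := hv2.resolve_right fun h => hAB' v hvA (h ▸ f2.2.1)
      subst hv1'
      subst hv2'
      simpa using heq
    · have hv1' : v = b := hv1.resolve_left fun h => hvA (h ▸ f1.1)
      have hv2' : v = b' := hv2.resolve_left fun h => hvA (h ▸ f2.1)
      subst hv1'
      subst hv2'
      rw [if_neg fun h : a = v => hvA (h ▸ f1.1), if_neg fun h : a' = v => hvA (h ▸ f2.1)] at heq
      rw [heq]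
  have hle : ∀ v ∈ U, subDeg H v ≤ M := by
    intro v hv
    rw [hdeg v hv]
    by_cases hvA : v ∈ A
    · refine le_trans (card_le_card fun p hp => ?_) (hM1 v)
      rw [mem_filter] at hp ⊢
      exact ⟨hp.1, (hp.2.2.resolve_right fun h => hAB' v hvA (by
        rw [h]
        exact (hFA p hp.1).2.1)).symm⟩
    · refine le_trans (card_le_card fun p hp => ?_) (hM2 v)
      rw [mem_filter] at hp ⊢
      exact ⟨hp.1, (hp.2.2.resolve_left fun h => hvA (by
        rw [h]
        exact (hFA p hp.1).1)).symm⟩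
  refine ⟨H, hU, fun v hv w hw => ?_, ?_⟩
  · have h1 : (subDeg H v : ℝ) ≤ M := by exact_mod_cast hle v hv
    have h2 := hUd w hw
    rw [← hdeg w hw] at h2
    linarith
  · have hedge : #{p ∈ F | p.1 ∈ U ∧ p.2 ∈ U} ≤ subEdgeCount H := by
      rw [← card_image_of_injOn (f := fun p : V × V => s(p.1, p.2)), subEdgeCount,
        ← Set.ncard_coe_finset]
      · refine Set.ncard_le_ncard ?_ (Set.toFinite _)
        rintro e he
        simp only [coe_image, coe_filter, Set.mem_image, Set.mem_ofPred_eq] at he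
        obtain ⟨p, ⟨hp, hp1, hp2⟩, rfl⟩ := he
        exact SimpleGraph.Subgraph.mem_edgeSet.2 ⟨Or.inl hp, hp1, hp2⟩
      · rintro ⟨a, b⟩ hp ⟨a', b'⟩ hp' heq
        simp only [coe_filter, Set.mem_ofPred_eq] at hp hp' heq
        rw [Sym2.eq_iff] at heq
        obtain ⟨rfl, rfl⟩ | ⟨rfl, rfl⟩ := heq
        · rfl
        · exact absurd (hFA _ hp'.1).2.1 (hAB' _ (hFA _ hp.1).1)
    have hedge' : (#{p ∈ F | p.1 ∈ U ∧ p.2 ∈ U} : ℝ) ≤ subEdgeCount H := by exact_mod_cast hedge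
    have hUpos : (0 : ℝ) < #U := by exact_mod_cast hU.card_pos
    have hv : H.verts.ncard = #U := Set.ncard_coe_finset U
    rw [subAvgDeg, hv, le_div_iff₀ hUpos]
    linarith

lemma exists_large_cut (E : Finset (V × V)) (hE : ∀ p ∈ E, p.1 ≠ p.2) (hne : E.Nonempty) :
    ∃ X : Finset V, (#E : ℝ) / 8 ≤ #{p ∈ E | p.1 ∈ X ∧ p.2 ∉ X} := by
  set A := E.image Prod.fst ∪ E.image Prod.snd
  have h1 : ∀ p ∈ E, p.1 ∈ A := fun p hp => mem_union_left _ (mem_image_of_mem _ hp)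
  have h2 : ∀ p ∈ E, p.2 ∈ A := fun p hp => mem_union_right _ (mem_image_of_mem _ hp)
  obtain ⟨X, -, hX⟩ := exists_pos_of_subsetMean_pos (A := A) (p := fun _ => 1 / 2)
    (f := fun X => ∑ p ∈ E, (subsetInd {p.1} X - subsetInd {p.1, p.2} X - 1 / 8 * subsetInd ∅ X))
    (fun _ _ => by norm_num) (by
      rw [subsetMean_sum]
      refine sum_pos (fun p hp => ?_) hne
      rw [subsetMean_sub, subsetMean_sub, subsetMean_const_mul,
        subsetMean_subsetInd _ (singleton_subset_iff.2 (h1 p hp)),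
        subsetMean_subsetInd _ (insert_subset (h1 p hp) (singleton_subset_iff.2 (h2 p hp))),
        subsetMean_subsetInd _ (empty_subset _), prod_pair (hE p hp)]
      norm_num)
  refine ⟨X, ?_⟩
  have h3 : ∀ p ∈ E, subsetInd {p.1} X - subsetInd {p.1, p.2} X - 1 / 8 * subsetInd ∅ X =
      (if p.1 ∈ X ∧ p.2 ∉ X then 1 else 0) - 1 / 8 := by
    intro p _
    by_cases ha : p.1 ∈ X <;> by_cases hb : p.2 ∈ X <;>
      simp [subsetInd, ha, hb, insert_subset_iff]
  rw [sum_congr rfl h3, sum_sub_distrib, sum_const, nsmul_eq_mul, ← sum_filter, sum_const,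
    nsmul_eq_mul] at hX
  linarith

lemma exists_bipartite_min_degree [Fintype V] {G : SimpleGraph V} {x : ℝ} (hx : 0 < x)
    (h : 80 * x ≤ avgDeg G) :
    ∃ A B : Finset V, Disjoint A B ∧ #A ≤ #B ∧ B.Nonempty ∧
      ∀ b ∈ B, 10 * x ≤ #{a ∈ A | G.Adj b a} := by
  have hV : (0 : ℝ) < Fintype.card V := by
    rcases Nat.eq_zero_or_pos (Fintype.card V) with h0 | h0
    · rw [avgDeg, h0] at h
      simp at h
      linarith
    · exact_mod_cast h0
  set E : Finset (V × V) := {p | G.Adj p.1 p.2}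
  have hE : (#E : ℝ) = 2 * edgeCount G := by
    have h1 : #E = 2 * edgeCount G := by
      rw [edgeCount, ← SimpleGraph.coe_edgeFinset, Set.ncard_coe_finset,
        ← SimpleGraph.dart_card_eq_twice_card_edges, ← Fintype.card_coe]
      refine Fintype.card_congr ⟨fun p => ⟨p.1, (mem_filter.1 p.2).2⟩,
        fun d => ⟨d.toProd, mem_filter.2 ⟨mem_univ _, d.adj⟩⟩, fun p => rfl, fun d => rfl⟩
    exact_mod_cast h1
  rw [avgDeg, ← hE, le_div_iff₀ hV] at h
  have hEne : E.Nonempty := by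
    rw [← card_pos]
    have : (0 : ℝ) < #E := lt_of_lt_of_le (by positivity) h
    exact_mod_cast this
  have hEadj : ∀ p ∈ E, G.Adj p.1 p.2 := fun p hp => (mem_filter.1 hp).2
  obtain ⟨X, hX⟩ := exists_large_cut E (fun p hp => G.ne_of_adj (hEadj p hp)) hEne
  obtain ⟨U, hU, -, hdeg⟩ := exists_min_degree (E := {p ∈ E | p.1 ∈ X ∧ p.2 ∉ X})
    (inc := fun p => {p.1, p.2}) (c := 10 * x) (U₀ := univ) (fun _ _ => insert_nonempty _ _)
    (univ_nonempty_iff.2 (Fintype.card_pos_iff.1 (by exact_mod_cast hV))) (by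
      rw [filter_true_of_mem fun _ _ => subset_univ _, card_univ]
      linarith)
  simp only [insert_subset_iff, singleton_subset_iff, mem_insert, mem_singleton,
    filter_filter] at hdeg
  have hl : ∀ v ∈ U ∩ X, 10 * x ≤ #{a ∈ U \ X | G.Adj v a} := by
    intro v hv
    rw [mem_inter] at hv
    refine (hdeg v hv.1).trans ?_
    norm_cast
    refine card_le_card_of_injOn Prod.snd (fun p hp => ?_) fun p hp q hq hpq => ?_
    · simp only [coe_filter, Set.mem_ofPred_eq] at hp
      obtain ⟨hpE, ⟨h1, h2⟩, ⟨h3, h4⟩, h5⟩ := hp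
      have h6 : v = p.1 := h5.resolve_right fun h => h2 (h ▸ hv.2)
      exact mem_filter.2 ⟨mem_sdiff.2 ⟨h4, h2⟩, h6 ▸ hEadj p hpE⟩
    · simp only [coe_filter, Set.mem_ofPred_eq] at hp hq
      exact Prod.ext ((hp.2.2.2.resolve_right fun h => hp.2.1.2 (h ▸ hv.2)).symm.trans
        (hq.2.2.2.resolve_right fun h => hq.2.1.2 (h ▸ hv.2))) hpq
  have hr : ∀ v ∈ U \ X, 10 * x ≤ #{a ∈ U ∩ X | G.Adj v a} := by
    intro v hv
    rw [mem_sdiff] at hv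
    refine (hdeg v hv.1).trans ?_
    norm_cast
    refine card_le_card_of_injOn Prod.fst (fun p hp => ?_) fun p hp q hq hpq => ?_
    · simp only [coe_filter, Set.mem_ofPred_eq] at hp
      obtain ⟨hpE, ⟨h1, h2⟩, ⟨h3, h4⟩, h5⟩ := hp
      have h6 : v = p.2 := h5.resolve_left fun h => hv.2 (h ▸ h1)
      exact mem_filter.2 ⟨mem_inter.2 ⟨h3, h1⟩, h6 ▸ (hEadj p hpE).symm⟩
    · simp only [coe_filter, Set.mem_ofPred_eq] at hp hq
      exact Prod.ext hpq ((hp.2.2.2.resolve_left fun h => hv.2 (h ▸ hp.2.1.1)).symm.trans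
        (hq.2.2.2.resolve_left fun h => hv.2 (h ▸ hq.2.1.1)))
  have hdisj : Disjoint (U ∩ X) (U \ X) :=
    disjoint_left.2 fun v h1 h2 => (mem_sdiff.1 h2).2 (mem_inter.1 h1).2
  have hcard := card_inter_add_card_sdiff U X
  have hpos := hU.card_pos
  rcases le_total #(U ∩ X) #(U \ X) with hle | hle
  · exact ⟨_, _, hdisj, hle, card_pos.1 (by omega), hr⟩
  · exact ⟨_, _, hdisj.symm, hle, card_pos.1 (by omega), hl⟩
end

section
open scoped Classical
variable {V : Type*}

lemma hasAlmostRegularSubgraph_of_adj {G : SimpleGraph V} {a b : V} (h : G.Adj a b) {c : ℝ}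
    (hc : c ≤ 1) : HasAlmostRegularSubgraph G 64 c := by
  refine ⟨G.subgraphOfAdj h, ⟨a, by simp⟩, ?_, ?_⟩
  · have hd : ∀ v ∈ (G.subgraphOfAdj h).verts, subDeg (G.subgraphOfAdj h) v = 1 := by
      rintro v (rfl | rfl)
      · rw [subDeg, SimpleGraph.neighborSet_fst_subgraphOfAdj, Set.ncard_singleton]
      · rw [subDeg, SimpleGraph.neighborSet_snd_subgraphOfAdj, Set.ncard_singleton]
    intro v hv w hw
    rw [hd v hv, hd w hw]
    norm_num
  · rw [subAvgDeg, subEdgeCount, SimpleGraph.edgeSet_subgraphOfAdj, Set.ncard_singleton,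
      SimpleGraph.subgraphOfAdj_verts, Set.ncard_pair (G.ne_of_adj h)]
    norm_num
    exact hc

lemma total_loss_le {r y ℓ s M L J : ℝ} (hr : 16 ≤ r) (hy : 64 ≤ y) (hℓ : 1 ≤ ℓ) (hs0 : 0 ≤ s)
    (hM0 : 0 ≤ M) (hL0 : 0 ≤ L) (hs : s ≤ r / y / 2) (hM : M ≤ r / y / 4) (hL : L ≤ 4 * y * ℓ)
    (hJ : J ≤ 2 * ℓ) : (8 * s * L + 1) * M + J * (8 * s * s) + 1 ≤ r ^ 2 * ℓ := by
  have hy0 : 0 < y := by linarith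
  have har : r / y * y = r := div_mul_cancel₀ _ hy0.ne'
  set a := r / y
  have ha0 : 0 ≤ a := div_nonneg (by linarith) hy0.le
  have ha : 64 * a ≤ r := by nlinarith
  have h1 : 8 * s * L * M ≤ r ^ 2 * ℓ / 16 := by
    calc 8 * s * L * M ≤ 8 * (a / 2) * (4 * y * ℓ) * (a / 4) := by gcongr
      _ = 4 * (a * y) * a * ℓ := by ring
      _ = r * (64 * a) * ℓ / 16 := by rw [har]; ring
      _ ≤ r * r * ℓ / 16 := by gcongr
      _ = r ^ 2 * ℓ / 16 := by ring
  have h2 : J * (8 * s * s) ≤ r ^ 2 * ℓ / 16 := by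
    calc J * (8 * s * s) ≤ 2 * ℓ * (8 * (a / 2) * (a / 2)) := by gcongr
      _ = (64 * a) * (64 * a) * ℓ / 1024 := by ring
      _ ≤ r * r * ℓ / 1024 := by gcongr
      _ ≤ r ^ 2 * ℓ / 16 := by
        have : 0 ≤ r ^ 2 * ℓ := by positivity
        nlinarith
  have h3 : r ≤ r ^ 2 * ℓ / 16 := by
    have : r * 16 * 1 ≤ r * r * ℓ := by gcongr
    nlinarith
  nlinarith

lemma card_common_superset_lt {G : SimpleGraph V} {k : ℕ} (hG : KkkFree G k) {A B : Finset V}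
    (hAB : Disjoint A B) {N : V → Finset V} (hN : ∀ b ∈ B, ∀ a ∈ N b, G.Adj b a) {K : Finset V}
    (hKA : K ⊆ A) (hKc : #K = k) : #{b ∈ B | K ⊆ N b} < k := by
  by_contra! h
  obtain ⟨T, hT, hTc⟩ := exists_subset_card_eq h
  refine hG ⟨K, T, hAB.mono hKA (hT.trans (filter_subset _ _)), hKc, hTc, fun u hu v hv => ?_⟩
  obtain ⟨hvB, hvK⟩ := mem_filter.1 (hT hv)
  exact (hN v hvB u (hvK hu)).symm

lemma hasAlmostRegularSubgraph_of_params [Fintype V] {G : SimpleGraph V} {k Δ M L J d₀ : ℕ}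
    (hM : 1 ≤ M) (hk : 1 ≤ k) (hG : KkkFree G k) (hdeg : ∀ v, deg G v ≤ Δ) {A B : Finset V}
    (hAB : Disjoint A B) (hcard : #A ≤ #B) (hB : B.Nonempty)
    (hnbr : ∀ b ∈ B, d₀ ≤ #{a ∈ A | G.Adj b a}) (hΔ : Δ ≤ 2 ^ 2 ^ J) (hL : 4 * d₀ ≤ 2 ^ L)
    (hL1 : 1 ≤ L) (hsd : 2 * M * k ≤ d₀)
    (hd : (8 * (2 * M * k) * L + 1) * M + J * (8 * (2 * M * k) * (2 * M * k)) + 1 ≤ d₀) :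
    HasAlmostRegularSubgraph G 64 (M / 32) := by
  have hsub : ∀ b ∈ B, ∃ Y ⊆ {a ∈ A | G.Adj b a}, #Y = d₀ := fun b hb =>
    exists_subset_card_eq (hnbr b hb)
  choose! N hN hNc using hsub
  have hadj : ∀ b ∈ B, ∀ a ∈ N b, a ∈ A ∧ G.Adj b a := fun b hb a ha =>
    mem_filter.1 (hN b hb ha)
  refine hasAlmostRegularSubgraph_of_hasDenseSub hAB hadj (hasDenseSub_of_large (A := A) hM hk rfl
    hB (fun b hb => ⟨fun a ha => (hadj b hb a ha).1, hNc b hb⟩) hcard (fun u _ => ?_) hΔ hL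
    (fun K => card_common_superset_lt hG hAB fun b hb a ha => (hadj b hb a ha).2) hd hsd hL1)
  refine le_trans ?_ (hdeg u)
  rw [deg, ← Set.ncard_coe_finset]
  refine Set.ncard_le_ncard (fun b hb => ?_) (Set.toFinite _)
  obtain ⟨hbB, hub⟩ := mem_filter.1 (mem_coe.1 hb)
  exact (hadj b hbB u hub).2.symm

lemma hasAlmostRegularSubgraph_of_avgDeg [Fintype V] {G : SimpleGraph V} {r k Δ : ℕ}
    (hr : 2 ^ 64 ≤ r) (hk : 1 ≤ k) (hΔ : 4 ≤ Δ) (hG : KkkFree G k) (hdeg : ∀ v, deg G v ≤ Δ)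
    (h : 80 * (r : ℝ) ^ 2 * Real.logb 2 (Real.logb 2 (Δ : ℝ)) ≤ avgDeg G) :
    HasAlmostRegularSubgraph G 64
      ((r : ℝ) / (160 * ((k : ℝ) + 1) * Real.logb 2 (r : ℝ))) := by
  have hr' : (2 : ℝ) ^ (64 : ℝ) ≤ r := by
    rw [show (64 : ℝ) = ((64 : ℕ) : ℝ) by norm_num, Real.rpow_natCast]
    exact_mod_cast hr
  have hr0 : (0 : ℝ) < r := lt_of_lt_of_le (by positivity) hr'
  have hr16 : (16 : ℝ) ≤ r := by
    have : 16 ≤ r := le_trans (by norm_num) hr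
    exact_mod_cast this
  have hy : 64 ≤ Real.logb 2 (r : ℝ) := (Real.le_logb_iff_rpow_le (by norm_num) hr0).2 hr'
  have hyr : (2 : ℝ) ^ Real.logb 2 (r : ℝ) = r := Real.rpow_logb (by norm_num) (by norm_num) hr0
  set y := Real.logb 2 (r : ℝ)
  have hΔ0 : (0 : ℝ) < Δ := by
    have : 0 < Δ := by omega
    exact_mod_cast this
  have hlog : 2 ≤ Real.logb 2 (Δ : ℝ) := by
    rw [Real.le_logb_iff_rpow_le (by norm_num) hΔ0]
    norm_num
    exact_mod_cast hΔ
  have hℓ : 1 ≤ Real.logb 2 (Real.logb 2 (Δ : ℝ)) := by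
    rw [Real.le_logb_iff_rpow_le (by norm_num) (by linarith), Real.rpow_one]
    exact hlog
  have hℓΔ : (2 : ℝ) ^ ((2 : ℝ) ^ Real.logb 2 (Real.logb 2 (Δ : ℝ))) = Δ := by
    rw [Real.rpow_logb (by norm_num) (by norm_num) (by linarith),
      Real.rpow_logb (by norm_num) (by norm_num) hΔ0]
  set ℓ := Real.logb 2 (Real.logb 2 (Δ : ℝ))
  have hrℓ : 1 ≤ (r : ℝ) ^ 2 * ℓ := by nlinarith
  obtain ⟨A, B, hAB, hcard, hB, hnbr⟩ := exists_bipartite_min_degree (x := (r : ℝ) ^ 2 * ℓ)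
    (by linarith) (by linarith)
  have hd₀ : (⌈(r : ℝ) ^ 2 * ℓ⌉₊ : ℝ) ≤ 2 * ((r : ℝ) ^ 2 * ℓ) := by
    have := Nat.ceil_lt_add_one (show 0 ≤ (r : ℝ) ^ 2 * ℓ by linarith)
    linarith
  have hnbr' : ∀ b ∈ B, ⌈(r : ℝ) ^ 2 * ℓ⌉₊ ≤ #{a ∈ A | G.Adj b a} := fun b hb =>
    Nat.ceil_le.2 (by linarith [hnbr b hb])
  set T : ℝ := (r : ℝ) / (160 * ((k : ℝ) + 1) * y) with hT
  rcases le_or_gt T 1 with hT1 | hT1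
  · obtain ⟨b, hb⟩ := hB
    have h1 : 0 < #{a ∈ A | G.Adj b a} :=
      lt_of_lt_of_le (Nat.ceil_pos.2 (by linarith)) (hnbr' b hb)
    obtain ⟨a, ha⟩ := card_pos.1 h1
    exact hasAlmostRegularSubgraph_of_adj (mem_filter.1 ha).2 hT1
  have hk1 : (1 : ℝ) ≤ k := by exact_mod_cast hk
  have hy0 : 0 < y := by linarith
  have hTr : T * ((k : ℝ) + 1) * 160 = r / y := by
    rw [hT]
    field_simp
  have hMl : 32 * T ≤ ⌈32 * T⌉₊ := Nat.le_ceil _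
  have hMu : (⌈32 * T⌉₊ : ℝ) ≤ 33 * T := by
    have := Nat.ceil_lt_add_one (show 0 ≤ 32 * T by linarith)
    linarith
  have hM1 : 1 ≤ ⌈32 * T⌉₊ := Nat.ceil_pos.2 (by linarith)
  set M := ⌈32 * T⌉₊
  have hs : 2 * (M : ℝ) * k ≤ r / y / 2 := by
    rw [← hTr]
    nlinarith [mul_le_mul_of_nonneg_right hMu (show (0 : ℝ) ≤ k by linarith)]
  have hM4 : (M : ℝ) ≤ r / y / 4 := by nlinarith
  have hLu : (⌈3 + 2 * y + ℓ⌉₊ : ℝ) ≤ 4 * y * ℓ := by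
    have := Nat.ceil_lt_add_one (show 0 ≤ 3 + 2 * y + ℓ by linarith)
    nlinarith
  have hJu : (⌈ℓ⌉₊ : ℝ) ≤ 2 * ℓ := by
    have := Nat.ceil_lt_add_one (show 0 ≤ ℓ by linarith)
    linarith
  have hloss := total_loss_le hr16 hy hℓ (by positivity) (Nat.cast_nonneg _) (Nat.cast_nonneg _)
    hs hM4 hLu hJu
  have hpow : (2 : ℝ) ^ ℓ ≤ 2 ^ ⌈ℓ⌉₊ := by
    rw [← Real.rpow_natCast]
    exact Real.rpow_le_rpow_of_exponent_le (by norm_num) (Nat.le_ceil _)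
  have hℓ2 : ℓ ≤ (2 : ℝ) ^ ℓ := by
    have := one_add_mul_self_le_rpow_one_add (show (-1 : ℝ) ≤ 1 by norm_num) hℓ
    norm_num at this
    linarith
  obtain ⟨H, hH1, hH2, hH3⟩ := hasAlmostRegularSubgraph_of_params (M := M)
    (L := ⌈3 + 2 * y + ℓ⌉₊) (J := ⌈ℓ⌉₊) hM1 hk hG hdeg hAB hcard hB hnbr' (by
      have h1 : (Δ : ℝ) ≤ 2 ^ 2 ^ ⌈ℓ⌉₊ := by
        rw [← hℓΔ, ← Real.rpow_natCast]
        refine Real.rpow_le_rpow_of_exponent_le (by norm_num) ?_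
        push_cast
        exact hpow
      exact_mod_cast h1) (by
      have h1 : 4 * (⌈(r : ℝ) ^ 2 * ℓ⌉₊ : ℝ) ≤ 2 ^ ⌈3 + 2 * y + ℓ⌉₊ := by
        calc 4 * (⌈(r : ℝ) ^ 2 * ℓ⌉₊ : ℝ) ≤ 8 * (r : ℝ) ^ 2 * ℓ := by linarith
          _ ≤ 8 * (r : ℝ) ^ 2 * 2 ^ ℓ := by gcongr
          _ = 2 ^ (3 + 2 * y + ℓ) := by
              rw [Real.rpow_add (by norm_num), Real.rpow_add (by norm_num), mul_comm 2 y,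
                Real.rpow_mul (by norm_num), hyr]
              norm_num
          _ ≤ 2 ^ ⌈3 + 2 * y + ℓ⌉₊ := by
              rw [← Real.rpow_natCast]
              exact Real.rpow_le_rpow_of_exponent_le (by norm_num) (Nat.le_ceil _)
      exact_mod_cast h1) (Nat.ceil_pos.2 (by linarith)) (by
      have h1 : r / y ≤ r := div_le_self hr0.le (by linarith)
      have h2 : 2 * (M : ℝ) * k ≤ ⌈(r : ℝ) ^ 2 * ℓ⌉₊ :=
        le_trans (by nlinarith) (Nat.le_ceil _)
      exact_mod_cast h2) (by
      have h1 := hloss.trans (Nat.le_ceil _)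
      exact_mod_cast h1)
  exact ⟨H, hH1, hH2, le_trans (by linarith) hH3⟩
end

end AlmostRegular

/-- For `r` sufficiently large: every `K_{k,k}`-free graph with maximum degree at most
`Δ ≥ 4` and average degree at least `80r²·log₂ log₂ Δ` has a `64`-almost-regular subgraph
with average degree at least `r/(160(k+1)·log₂ r)`. -/
theorem general_main_result :
    ∃ r₀ : ℕ, ∀ (V : Type) [Fintype V] (r k Δ : ℕ), r₀ ≤ r → 0 < k → 4 ≤ Δ →
      ∀ G : SimpleGraph V, KkkFree G k →
      (∀ v, deg G v ≤ Δ) →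
      80 * (r : ℝ) ^ 2 * Real.logb 2 (Real.logb 2 (Δ : ℝ)) ≤ avgDeg G →
      HasAlmostRegularSubgraph G 64
        ((r : ℝ) / (160 * ((k : ℝ) + 1) * Real.logb 2 (r : ℝ))) := by
  exact ⟨2 ^ 64, fun _ _ _ _ _ hr hk hΔ _ hG hdeg h =>
    AlmostRegular.hasAlmostRegularSubgraph_of_avgDeg hr hk hΔ hG hdeg h⟩
end
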